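/- arXiv:math/0603585 — 4 statements merged into one kernel-verified Lean document; each statement's English description precedes it below -/
import Mathlib

section
/- Let k ≥ 2 and let b > 0 be a constant. Then there exists a constant c > 0 depending only on k and b such that for every nonempty finite set Z and every S ⊆ {0,1,…,k}^Z with F_S ≥ k^{b|Z|}, there exists a subset W ⊆ Z with |W| ≥ c|Z| and S|_W ⊇ {1,…,k}^W. -/
open Classical in
/-- The subsets `W` of `A` with `S|_W ⊇ {1,…,k}^W`. -/
noncomputable def shatteredSubsets {k : ℕ} {Z : Type} (A : Finset Z) (S : Set (Z → Fin (k + 1))) :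
    Finset (Finset Z) :=
  A.powerset.filter fun W =>
    ∀ g : Z → Fin (k + 1), (∀ z ∈ W, g z ≠ 0) → ∃ f ∈ S, ∀ z ∈ W, f z = g z

theorem mem_shatteredSubsets {k : ℕ} {Z : Type} {A W : Finset Z} {S : Set (Z → Fin (k + 1))} :
    W ∈ shatteredSubsets A S ↔ W ⊆ A ∧
      ∀ g : Z → Fin (k + 1), (∀ z ∈ W, g z ≠ 0) → ∃ f ∈ S, ∀ z ∈ W, f z = g z := by
  simp [shatteredSubsets]

/-- `𝒥` is a family of nowhere zero functions such that every member of `S` differs from some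
member of `𝒥` at all points of `A`. -/
def IsAvoidingCover {k : ℕ} {Z : Type} (A : Finset Z) (S : Set (Z → Fin (k + 1)))
    (𝒥 : Finset (Z → Fin (k + 1))) : Prop :=
  (∀ u ∈ 𝒥, ∀ z, u z ≠ 0) ∧ ∀ f ∈ S, ∃ u ∈ 𝒥, ∀ z ∈ A, f z ≠ u z

theorem shatteredSubsets_subset_of_insert {k : ℕ} {Z : Type} [DecidableEq Z] {A : Finset Z}
    {z : Z} {S T : Set (Z → Fin (k + 1))} (hT : T ⊆ S) :
    shatteredSubsets A T ⊆ shatteredSubsets (insert z A) S := by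
  intro W hW
  simp only [mem_shatteredSubsets] at hW ⊢
  refine ⟨hW.1.trans (Finset.subset_insert z A), fun g hg => ?_⟩
  obtain ⟨f, hf, h⟩ := hW.2 g hg
  exact ⟨f, hT hf, h⟩

theorem insert_mem_shatteredSubsets {k : ℕ} {Z : Type} [DecidableEq Z] {A W : Finset Z} {z : Z}
    {S : Set (Z → Fin (k + 1))}
    (hW : ∀ i : Fin k, W ∈ shatteredSubsets A {f ∈ S | f z = i.succ}) (hWA : W ⊆ A) :
    insert z W ∈ shatteredSubsets (insert z A) S := by
  simp only [mem_shatteredSubsets] at hW ⊢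
  refine ⟨Finset.insert_subset_insert z hWA, fun g hg => ?_⟩
  obtain ⟨i, hi⟩ := Fin.exists_succ_eq.2 (hg z (Finset.mem_insert_self z W))
  obtain ⟨f, ⟨hfS, hfz⟩, hf⟩ := (hW i).2 g fun y hy => hg y (Finset.mem_insert_of_mem hy)
  refine ⟨f, hfS, fun y hy => ?_⟩
  rcases Finset.mem_insert.1 hy with rfl | hy
  · rw [hfz, hi]
  · exact hf y hy

/-- Adding a coordinate: `∑ᵢ |sh(Sᵢ)| ≤ (k - 1) |sh(S)|` for the slices `Sᵢ` of `S`. -/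
theorem sum_card_shatteredSubsets_le {k : ℕ} (hk : 2 ≤ k) {Z : Type} [DecidableEq Z]
    {A : Finset Z} {z : Z} (hz : z ∉ A) (S : Set (Z → Fin (k + 1))) :
    ∑ i : Fin k, (shatteredSubsets A {f ∈ S | f z = i.succ}).card ≤
      (k - 1) * (shatteredSubsets (insert z A) S).card := by
  classical
  have hcard : ∀ (B : Finset Z) (T : Set (Z → Fin (k + 1))),
      (shatteredSubsets B T).card = ∑ W ∈ B.powerset, if W ∈ shatteredSubsets B T then 1 else 0 := by
    intro B T
    rw [← Finset.card_filter]
    congr 1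
    ext W
    simp +contextual [mem_shatteredSubsets]
  simp_rw [hcard]
  rw [Finset.sum_powerset_insert hz, Finset.sum_comm, ← Finset.sum_add_distrib, Finset.mul_sum]
  refine Finset.sum_le_sum fun W hW => ?_
  have hWA := Finset.mem_powerset.1 hW
  rw [← Finset.card_filter]
  by_cases hall : ∀ i : Fin k, W ∈ shatteredSubsets A {f ∈ S | f z = i.succ}
  · rw [if_pos (shatteredSubsets_subset_of_insert (Set.sep_subset _ _) (hall ⟨0, by omega⟩)),
      if_pos (insert_mem_shatteredSubsets hall hWA)]
    have := Finset.card_filter_le (Finset.univ : Finset (Fin k))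
      (fun i => W ∈ shatteredSubsets A {f ∈ S | f z = i.succ})
    rw [Finset.card_univ, Fintype.card_fin] at this
    omega
  · by_cases hex : ∃ i : Fin k, W ∈ shatteredSubsets A {f ∈ S | f z = i.succ}
    · obtain ⟨i, hi⟩ := hex
      rw [if_pos (shatteredSubsets_subset_of_insert (Set.sep_subset _ _) hi)]
      obtain ⟨j, hj⟩ := not_forall.1 hall
      have hlt : Finset.univ.filter (fun i : Fin k =>
          W ∈ shatteredSubsets A {f ∈ S | f z = i.succ}) ⊂ Finset.univ :=
        Finset.filter_ssubset.2 ⟨j, Finset.mem_univ j, hj⟩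
      have := Finset.card_lt_card hlt
      rw [Finset.card_univ, Fintype.card_fin] at this
      calc _ ≤ (k - 1) * 1 := by omega
        _ ≤ _ := Nat.mul_le_mul_left _ (by omega)
    · rw [Finset.filter_false_of_mem fun i _ hi => hex ⟨i, hi⟩]
      simp

theorem IsAvoidingCover.insert {k : ℕ} {Z : Type} [DecidableEq Z]
    [DecidableEq (Z → Fin (k + 1))] {A : Finset Z} {z : Z}
    {S : Set (Z → Fin (k + 1))} {i : Fin (k + 1)} {𝒥 : Finset (Z → Fin (k + 1))}
    (h𝒥 : IsAvoidingCover A S 𝒥) (hi : i ≠ 0) (hS : ∀ f ∈ S, f z ≠ i) :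
    IsAvoidingCover (insert z A) S (𝒥.image fun u => Function.update u z i) := by
  refine ⟨fun u hu y => ?_, fun f hf => ?_⟩
  · obtain ⟨v, hv, rfl⟩ := Finset.mem_image.1 hu
    by_cases hy : y = z
    · subst hy; simpa using hi
    · simpa [hy] using h𝒥.1 v hv y
  · obtain ⟨u, hu, h⟩ := h𝒥.2 f hf
    refine ⟨_, Finset.mem_image_of_mem _ hu, fun y hy => ?_⟩
    by_cases hyz : y = z
    · subst hyz; simpa using hS f hf
    · simpa [hyz] using h y ((Finset.mem_insert.1 hy).resolve_left hyz)

/-- A set with few shattered subsets has a small cover. -/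
theorem exists_isAvoidingCover_card_le {k : ℕ} (hk : 2 ≤ k) {Z : Type} {ε : ℝ} (hε : 0 < ε)
    {p : ℕ} (hp : (((k : ℝ) - 1) / k) ^ p ≤ ε) (A : Finset Z) (S : Set (Z → Fin (k + 1))) :
    ∃ 𝒥, IsAvoidingCover A S 𝒥 ∧
      (𝒥.card : ℝ) ≤ (1 + ε) ^ A.card * ((shatteredSubsets A S).card : ℝ) ^ p := by
  classical
  have hk0 : (0 : ℝ) < k := by positivity
  induction A using Finset.induction_on generalizing S with
  | empty =>
    rcases S.eq_empty_or_nonempty with rfl | ⟨f, hf⟩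
    · exact ⟨∅, ⟨by simp, by simp⟩, by simp⟩
    · refine ⟨{fun _ => Fin.succ ⟨0, by omega⟩}, ⟨by simp, by simp⟩, ?_⟩
      have : shatteredSubsets ∅ S = {∅} := by
        ext W
        simp only [mem_shatteredSubsets, Finset.subset_empty, Finset.mem_singleton,
          and_iff_left_iff_imp]
        rintro rfl g -
        exact ⟨f, hf, by simp⟩
      simp [this]
  | insert z A hz ih =>
    set s := (shatteredSubsets (insert z A) S).card with hs
    obtain ⟨i, hi⟩ : ∃ i : Fin k,
        k * (shatteredSubsets A {f ∈ S | f z = i.succ}).card ≤ (k - 1) * s := by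
      by_contra! h
      have h1 := sum_card_shatteredSubsets_le hk hz S
      have h2 : ∑ _i : Fin k, ((k - 1) * s) <
          ∑ i : Fin k, k * (shatteredSubsets A {f ∈ S | f z = i.succ}).card :=
        Finset.sum_lt_sum_of_nonempty ⟨⟨0, by omega⟩, Finset.mem_univ _⟩ fun i _ => h i
      rw [Finset.sum_const, ← Finset.mul_sum, Finset.card_univ, Fintype.card_fin,
        smul_eq_mul] at h2
      exact h1.not_gt (Nat.lt_of_mul_lt_mul_left h2)
    obtain ⟨j, hj⟩ : ∃ j : Fin k, j ≠ i :=
      have : Nontrivial (Fin k) := Fin.nontrivial_iff_two_le.2 hk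
      exists_ne i
    obtain ⟨𝒥₁, h₁, hc₁⟩ := ih {f ∈ S | f z ≠ i.succ}
    obtain ⟨𝒥₂, h₂, hc₂⟩ := ih {f ∈ S | f z = i.succ}
    have h₁' := h₁.insert (z := z) (Fin.succ_ne_zero i) fun f hf => hf.2
    have h₂' := h₂.insert (z := z) (Fin.succ_ne_zero j) fun f hf => by
      rw [hf.2]; exact fun h => hj (Fin.succ_injective _ h).symm
    refine ⟨𝒥₁.image (fun u => Function.update u z i.succ) ∪
      𝒥₂.image (fun u => Function.update u z j.succ), ⟨fun u hu => ?_, fun f hf => ?_⟩, ?_⟩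
    · exact (Finset.mem_union.1 hu).elim (h₁'.1 u) (h₂'.1 u)
    · by_cases hfi : f z = i.succ
      · obtain ⟨u, hu, h⟩ := h₂'.2 f ⟨hf, hfi⟩
        exact ⟨u, Finset.mem_union_right _ hu, h⟩
      · obtain ⟨u, hu, h⟩ := h₁'.2 f ⟨hf, hfi⟩
        exact ⟨u, Finset.mem_union_left _ hu, h⟩
    · have hcard : ((𝒥₁.image (fun u => Function.update u z i.succ) ∪
          𝒥₂.image (fun u => Function.update u z j.succ)).card : ℝ) ≤ 𝒥₁.card + 𝒥₂.card := by
        exact_mod_cast (Finset.card_union_le _ _).trans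
          (add_le_add Finset.card_image_le Finset.card_image_le)
      have hs₁ : ((shatteredSubsets A {f ∈ S | f z ≠ i.succ}).card : ℝ) ≤ s := by
        exact_mod_cast Finset.card_le_card
          (shatteredSubsets_subset_of_insert (Set.sep_subset _ _))
      have hs₂ : ((shatteredSubsets A {f ∈ S | f z = i.succ}).card : ℝ) ≤
          ((k : ℝ) - 1) / k * s := by
        rw [div_mul_eq_mul_div, le_div_iff₀ hk0, mul_comm]
        have : ((k * (shatteredSubsets A {f ∈ S | f z = i.succ}).card : ℕ) : ℝ) ≤
          (((k - 1) * s : ℕ) : ℝ) := by exact_mod_cast hi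
        rwa [Nat.cast_mul, Nat.cast_mul, Nat.cast_sub (by omega), Nat.cast_one] at this
      have hp₂ : ((shatteredSubsets A {f ∈ S | f z = i.succ}).card : ℝ) ^ p ≤ ε * (s : ℝ) ^ p :=
        calc _ ≤ (((k : ℝ) - 1) / k * s) ^ p := by gcongr
          _ = (((k : ℝ) - 1) / k) ^ p * (s : ℝ) ^ p := mul_pow _ _ _
          _ ≤ _ := by gcongr
      rw [Finset.card_insert_of_notMem hz]
      calc _ ≤ _ := hcard
        _ ≤ (1 + ε) ^ A.card * (s : ℝ) ^ p + (1 + ε) ^ A.card * (ε * (s : ℝ) ^ p) := by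
          refine add_le_add (hc₁.trans ?_) (hc₂.trans ?_) <;> gcongr
        _ = _ := by ring

/-- A family of subsets of sizes at most `d` has at most `x ^ (-d) * (1 + x) ^ n` members. -/
theorem card_mul_rpow_le_of_card_le {Z : Type} [Fintype Z] {x d : ℝ} (hx : 0 < x) (hx1 : x ≤ 1)
    (𝒲 : Finset (Finset Z)) (h : ∀ W ∈ 𝒲, (W.card : ℝ) ≤ d) :
    (𝒲.card : ℝ) * x ^ d ≤ (1 + x) ^ Fintype.card Z := by
  classical
  calc (𝒲.card : ℝ) * x ^ d = ∑ _W ∈ 𝒲, x ^ d := by simp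
    _ ≤ ∑ W ∈ 𝒲, x ^ W.card := Finset.sum_le_sum fun W hW => by
        rw [← Real.rpow_natCast]
        exact Real.rpow_le_rpow_of_exponent_ge hx hx1 (h W hW)
    _ ≤ ∑ W : Finset Z, x ^ W.card :=
        Finset.sum_le_sum_of_subset_of_nonneg (Finset.subset_univ _) fun _ _ _ => by positivity
    _ = (1 + x) ^ Fintype.card Z := by
        rw [add_comm, ← Fintype.sum_pow_mul_eq_add_pow]; simp

theorem exists_pow_one_add_lt_mul_rpow {a : ℝ} (ha : 1 < a) (p : ℕ) :
    ∃ x c : ℝ, 0 < x ∧ x ≤ 1 ∧ 0 < c ∧ (1 + x) ^ p < a * (x ^ c) ^ p := by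
  open Filter Topology in
  have h₁ : Tendsto (fun x : ℝ => (1 + x) ^ p) (𝓝[>] 0) (𝓝 1) := by
    have : ContinuousAt (fun x : ℝ => (1 + x) ^ p) 0 := by fun_prop
    simpa [ContinuousAt] using this.tendsto.mono_left nhdsWithin_le_nhds
  obtain ⟨x, hx, hx0, hx1⟩ := ((h₁.eventually_lt_const ha).and
    (Ioc_mem_nhdsGT (zero_lt_one' ℝ))).exists
  have h₂ : Tendsto (fun c : ℝ => a * (x ^ c) ^ p) (𝓝[>] 0) (𝓝 a) := by
    have : ContinuousAt (fun c : ℝ => a * (x ^ c) ^ p) 0 :=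
      continuousAt_const.mul ((Real.continuousAt_const_rpow hx0.ne').pow p)
    simpa [ContinuousAt] using this.tendsto.mono_left nhdsWithin_le_nhds
  obtain ⟨c, hc, hc0⟩ := ((h₂.eventually_const_lt hx).and self_mem_nhdsWithin).exists
  exact ⟨x, c, hx0, hx1, hc0, hc⟩

/-- the key combinatorial lemma (Lemma 3.3 / `L-key`).
Values in `Fin (k+1)` represent `{0,1,…,k}`; the members of the cover `𝒰`
are the sets `{f | ∀ z, f z ≠ u z}` for `u : Z → Fin (k+1)` with `u z ≠ 0`
(i.e. `1 ≤ u z ≤ k`) for all `z`.  The hypothesis says that every finite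
family of members of `𝒰` covering `S` has cardinality at least
`k ^ (b * |Z|)`, i.e. `F_S ≥ k^{b|Z|}`.  The conclusion produces `W ⊆ Z`
with `|W| ≥ c|Z|` and `S|_W ⊇ {1,…,k}^W`. -/
theorem stmt0 (k : ℕ) (hk : 2 ≤ k) (b : ℝ) (hb : 0 < b) :
    ∃ c : ℝ, 0 < c ∧
      ∀ (Z : Type) [Fintype Z] [Nonempty Z] (S : Set (Z → Fin (k + 1))),
        (∀ 𝒥 : Finset (Z → Fin (k + 1)),
            (∀ u ∈ 𝒥, ∀ z : Z, u z ≠ 0) →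
            S ⊆ ⋃ u ∈ 𝒥, {f : Z → Fin (k + 1) | ∀ z : Z, f z ≠ u z} →
            (k : ℝ) ^ (b * (Fintype.card Z : ℝ)) ≤ (𝒥.card : ℝ)) →
        ∃ W : Finset Z, c * (Fintype.card Z : ℝ) ≤ (W.card : ℝ) ∧
          ∀ g : Z → Fin (k + 1), (∀ z ∈ W, g z ≠ 0) →
            ∃ f ∈ S, ∀ z ∈ W, f z = g z := by
  have hk1 : (1 : ℝ) < k := by exact_mod_cast hk
  have hk0 : (0 : ℝ) < k := by linarith
  set a : ℝ := (k : ℝ) ^ (b / 2) with ha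
  have ha1 : 1 < a := Real.one_lt_rpow hk1 (by positivity)
  have ha0 : 0 < a := by linarith
  obtain ⟨p, hp⟩ := exists_pow_lt_of_lt_one (sub_pos.2 ha1)
    (show ((k : ℝ) - 1) / k < 1 by rw [div_lt_one hk0]; linarith)
  obtain ⟨x, c, hx0, hx1, hc, hlt⟩ := exists_pow_one_add_lt_mul_rpow ha1 p
  refine ⟨c, hc, fun Z _ _ S hS => ?_⟩
  by_contra! hW
  obtain ⟨𝒥, h𝒥, hcard⟩ :=
    exists_isAvoidingCover_card_le hk (sub_pos.2 ha1) hp.le (Finset.univ : Finset Z) S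
  set n := Fintype.card Z
  set s := (shatteredSubsets (Finset.univ : Finset Z) S).card
  have hlow : (k : ℝ) ^ (b * (n : ℝ)) ≤ 𝒥.card := by
    refine hS 𝒥 h𝒥.1 fun f hf => ?_
    obtain ⟨u, hu, h⟩ := h𝒥.2 f hf
    exact Set.mem_biUnion hu fun z => h z (Finset.mem_univ z)
  have hpow : (k : ℝ) ^ (b * (n : ℝ)) = a ^ n * a ^ n := by
    rw [ha, ← mul_pow, ← Real.rpow_add hk0, add_halves, Real.rpow_mul hk0.le, Real.rpow_natCast]
  have hsp : a ^ n ≤ (s : ℝ) ^ p := by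
    have := hlow.trans hcard
    rw [hpow, add_sub_cancel, Finset.card_univ] at this
    exact le_of_mul_le_mul_left this (by positivity)
  have hs : (s : ℝ) * x ^ (c * (n : ℝ)) ≤ (1 + x) ^ n := by
    refine card_mul_rpow_le_of_card_le hx0 hx1 _ fun W hWs => ?_
    by_contra! hcW
    obtain ⟨g, hg, h⟩ := hW W hcW.le
    obtain ⟨f, hf, hfg⟩ := (mem_shatteredSubsets.1 hWs).2 g hg
    obtain ⟨z, hz, hne⟩ := h f hf
    exact hne (hfg z hz)
  rw [Real.rpow_mul hx0.le, Real.rpow_natCast] at hs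
  have hcontra : (a * (x ^ c) ^ p) ^ n ≤ ((1 + x) ^ p) ^ n :=
    calc (a * (x ^ c) ^ p) ^ n = a ^ n * ((x ^ c) ^ n) ^ p := by
          rw [mul_pow, pow_right_comm]
      _ ≤ (s : ℝ) ^ p * ((x ^ c) ^ n) ^ p := by gcongr
      _ = ((s : ℝ) * (x ^ c) ^ n) ^ p := (mul_pow _ _ _).symm
      _ ≤ ((1 + x) ^ n) ^ p := by gcongr
      _ = ((1 + x) ^ p) ^ n := pow_right_comm _ _ _
  exact hcontra.not_gt (pow_lt_pow_left₀ hlt (by positivity) Fintype.card_ne_zero)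
end

section
/- Let Z be a finite set with Z ∩ {1,2,3} = ∅. There exists a constant c > 0 depending only on |Z| such that, for all n ∈ ℕ, if S ⊆ (Z ∪ {1,2})^{{1,…,n}} is such that the restriction Γ_n|_S : S → (Z ∪ {3})^{{1,…,n}} is a bijection onto (Z ∪ {3})^{{1,…,n}}, where Γ_n : (Z ∪ {1,2})^{{1,…,n}} → (Z ∪ {3})^{{1,…,n}} is the map converting the coordinate values 1 and 2 to 3 (and leaving values in Z unchanged), then there exists I ⊆ {1,…,n} with |I| ≥ cn such that either S|_I ⊇ (Z ∪ {1})^I or S|_I ⊇ (Z ∪ {2})^I. -/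
/-- `S` restricted to `I` contains every word that avoids, at each `i ∈ I`, the letter
`Sum.inr (!ε i)`. -/
def ColorShatters {ι Z : Type} (S : Set (ι → Z ⊕ Bool)) (I : Finset ι) (ε : ι → Bool) : Prop :=
  ∀ g : ι → Z ⊕ Bool, (∀ i ∈ I, g i ≠ Sum.inr (!ε i)) → ∃ f ∈ S, ∀ i ∈ I, f i = g i

/-- Letters of `Z` weigh `1`, the two extra letters weigh `1 / 2` each. -/
noncomputable def letterWeight {Z : Type} : Z ⊕ Bool → ℝ :=
  Sum.elim (fun _ => 1) fun _ => 1 / 2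

theorem letterWeight_nonneg {Z : Type} (a : Z ⊕ Bool) : 0 ≤ letterWeight a := by
  rcases a with z | b <;> simp [letterWeight]

open Classical in
/-- Total weight of the words of length `n` in `S`. -/
noncomputable def weight {Z : Type} [Fintype Z] {n : ℕ} (S : Set (Fin n → Z ⊕ Bool)) : ℝ :=
  ∑ f, if f ∈ S then ∏ i, letterWeight (f i) else 0

theorem ColorShatters.of_exists_cons {Z : Type} {n : ℕ} {S : Set (Fin (n + 1) → Z ⊕ Bool)}
    {I : Finset (Fin n)} {ε : Fin n → Bool}
    (h : ColorShatters {g | ∃ a, (Fin.cons a g : Fin (n + 1) → Z ⊕ Bool) ∈ S} I ε) :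
    ColorShatters S (I.map (Fin.succEmb n)) (Fin.cons false ε) := by
  intro g hg
  obtain ⟨f, ⟨a, ha⟩, hf⟩ := h (fun i => g i.succ) fun i hi => by
    simpa using hg i.succ (by simpa using hi)
  refine ⟨_, ha, fun i hi => ?_⟩
  obtain ⟨j, hj, rfl⟩ := Finset.mem_map.1 hi
  simpa using hf j hj

theorem ColorShatters.of_forall_cons {Z : Type} {n : ℕ} {S : Set (Fin (n + 1) → Z ⊕ Bool)}
    {I : Finset (Fin n)} {ε : Fin n → Bool} {b : Bool}
    (h : ColorShatters {g | (∀ z, (Fin.cons (Sum.inl z) g : Fin (n + 1) → Z ⊕ Bool) ∈ S) ∧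
      (Fin.cons (Sum.inr b) g : Fin (n + 1) → Z ⊕ Bool) ∈ S} I ε) :
    ColorShatters S (insert 0 (I.map (Fin.succEmb n))) (Fin.cons b ε) := by
  intro g hg
  obtain ⟨f, ⟨hz, hb⟩, hf⟩ := h (fun i => g i.succ) fun i hi => by
    simpa using hg i.succ (by simpa using hi)
  have hmem : (Fin.cons (g 0) f : Fin (n + 1) → Z ⊕ Bool) ∈ S := by
    have h0 := hg 0 (by simp)
    rcases hg0 : g 0 with z | b'
    · exact hz z
    · have : b' = b := by
        rw [hg0] at h0
        cases b <;> cases b' <;> simp_all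
      exact this ▸ hb
  refine ⟨_, hmem, fun i hi => ?_⟩
  rcases Finset.mem_insert.1 hi with rfl | hi
  · simp
  · obtain ⟨j, hj, rfl⟩ := Finset.mem_map.1 hi
    simpa using hf j hj

theorem weight_le_slices {Z : Type} [Fintype Z] {n : ℕ} (S : Set (Fin (n + 1) → Z ⊕ Bool)) :
    weight S ≤ Fintype.card Z *
        weight {g | ∃ a, (Fin.cons a g : Fin (n + 1) → Z ⊕ Bool) ∈ S} +
      ∑ b : Bool, 1 / 2 *
        weight {g | (∀ z, (Fin.cons (Sum.inl z) g : Fin (n + 1) → Z ⊕ Bool) ∈ S) ∧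
          (Fin.cons (Sum.inr b) g : Fin (n + 1) → Z ⊕ Bool) ∈ S} := by
  classical
  unfold weight
  rw [← (Fin.consEquiv fun _ => Z ⊕ Bool).sum_comp, Fintype.sum_prod_type_right]
  simp only [Finset.mul_sum, Fintype.sum_bool, ← Finset.sum_add_distrib]
  refine Finset.sum_le_sum fun g _ => ?_
  have hP : 0 ≤ ∏ i, letterWeight (g i) := Finset.prod_nonneg fun i _ => letterWeight_nonneg _
  have hcons (a : Z ⊕ Bool) : Fin.consEquiv (fun _ => Z ⊕ Bool) (a, g) = Fin.cons a g := rfl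
  simp only [hcons, Fin.prod_univ_succ, Fin.cons_zero, Fin.cons_succ,
    Fintype.sum_sum_type, Set.mem_ofPred_eq, Fintype.sum_bool, letterWeight, Sum.elim_inl,
    Sum.elim_inr, one_mul] at hP ⊢
  generalize (∏ i, Sum.elim (fun _ => (1 : ℝ)) (fun _ => 1 / 2) (g i)) = P at hP ⊢
  rw [← Finset.sum_filter, Finset.sum_const, nsmul_eq_mul]
  set m := (Finset.univ.filter fun z : Z =>
    (Fin.cons (Sum.inl z) g : Fin (n + 1) → Z ⊕ Bool) ∈ S).card with hm
  by_cases hall : ∀ z, (Fin.cons (Sum.inl z) g : Fin (n + 1) → Z ⊕ Bool) ∈ S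
  · have hmk : m = Fintype.card Z := by
      rw [hm, Finset.filter_true_of_mem fun z _ => hall z, Finset.card_univ]
    simp only [hall, hmk, implies_true, true_and]
    by_cases hU : ∃ a, (Fin.cons a g : Fin (n + 1) → Z ⊕ Bool) ∈ S
    · simp only [hU, if_true]
      split_ifs <;> linarith
    · have hk : Fintype.card Z = 0 := by
        rw [Fintype.card_eq_zero_iff]
        exact ⟨fun z => hU ⟨_, hall z⟩⟩
      rw [hk]
      split_ifs <;> simp
  · simp only [hall, false_and, if_false]
    have hmk : (m : ℝ) + 1 ≤ Fintype.card Z := by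
      have : m < Fintype.card Z := by
        push Not at hall
        obtain ⟨z, hz⟩ := hall
        exact Finset.card_lt_univ_of_notMem (x := z) (by simpa using hz)
      exact_mod_cast this
    by_cases hU : ∃ a, (Fin.cons a g : Fin (n + 1) → Z ⊕ Bool) ∈ S
    · simp only [hU, if_true]
      have := mul_le_mul_of_nonneg_right hmk hP
      split_ifs <;> linarith
    · push Not at hU
      have hm0 : m = 0 := by simp [hm, hU]
      simp [hU, hm0]

/-- A Sauer–Shelah type bound for coloured shattering. -/
theorem weight_le_of_colorShatters_card_le {Z : Type} [Fintype Z] {n : ℕ}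
    (S : Set (Fin n → Z ⊕ Bool)) (d : ℕ) (hd : ∀ I ε, ColorShatters S I ε → I.card ≤ d) :
    weight S ≤ ((Fintype.card Z : ℝ) + 1 / 4) ^ n * 4 ^ d := by
  classical
  induction n generalizing d with
  | zero =>
    have h4 : (1 : ℝ) ≤ 4 ^ d := one_le_pow₀ (by norm_num)
    simp only [weight, Fintype.sum_unique, Finset.univ_eq_empty, Finset.prod_empty, pow_zero,
      one_mul]
    split_ifs <;> linarith
  | succ n ih =>
    have hU := ih {g | ∃ a, (Fin.cons a g : Fin (n + 1) → Z ⊕ Bool) ∈ S} d fun I ε h => by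
      simpa using hd _ _ h.of_exists_cons
    have hV (b : Bool) :
        weight {g | (∀ z, (Fin.cons (Sum.inl z) g : Fin (n + 1) → Z ⊕ Bool) ∈ S) ∧
          (Fin.cons (Sum.inr b) g : Fin (n + 1) → Z ⊕ Bool) ∈ S} ≤
        ((Fintype.card Z : ℝ) + 1 / 4) ^ n * 4 ^ d / 4 := by
      have hcard : ∀ I ε, ColorShatters {g |
          (∀ z, (Fin.cons (Sum.inl z) g : Fin (n + 1) → Z ⊕ Bool) ∈ S) ∧
          (Fin.cons (Sum.inr b) g : Fin (n + 1) → Z ⊕ Bool) ∈ S} I ε → I.card + 1 ≤ d := by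
        intro I ε h
        have := hd _ _ h.of_forall_cons
        rwa [Finset.card_insert_of_notMem (by simp), Finset.card_map] at this
      cases d with
      | zero =>
        have hempty : {g | (∀ z, (Fin.cons (Sum.inl z) g : Fin (n + 1) → Z ⊕ Bool) ∈ S) ∧
            (Fin.cons (Sum.inr b) g : Fin (n + 1) → Z ⊕ Bool) ∈ S} = ∅ := by
          refine Set.eq_empty_of_forall_notMem fun g hg => ?_
          simpa using hcard ∅ (fun _ => false) fun _ _ => ⟨g, hg, by simp⟩
        rw [hempty]
        simp only [weight, Set.mem_empty_iff_false, if_false, Finset.sum_const_zero]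
        positivity
      | succ d =>
        refine (ih _ d fun I ε h => Nat.le_of_succ_le_succ (hcard I ε h)).trans_eq ?_
        ring
    refine (weight_le_slices S).trans ?_
    rw [Fintype.sum_bool, pow_succ]
    have := mul_le_mul_of_nonneg_left hU (Nat.cast_nonneg (α := ℝ) (Fintype.card Z))
    linarith [hV true, hV false]

theorem weight_eq_of_bijOn {Z : Type} [Fintype Z] {n : ℕ} {S : Set (Fin n → Z ⊕ Bool)}
    (hS : Set.BijOn
      (fun f => (Sum.elim (fun z => (some z : Option Z)) fun _ => (none : Option Z)) ∘ f)
      S Set.univ) :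
    weight S = ((Fintype.card Z : ℝ) + 1 / 2) ^ n := by
  classical
  set w : Option Z → ℝ := fun o => o.elim (1 / 2) fun _ => 1 with hw
  have hsum : ∑ o, w o = (Fintype.card Z : ℝ) + 1 / 2 := by
    simp [hw, Fintype.sum_option, add_comm]
  rw [weight, ← Finset.sum_filter, ← hsum, Fintype.sum_pow]
  refine Finset.sum_bij
    (fun f _ => (Sum.elim (fun z => (some z : Option Z)) fun _ => (none : Option Z)) ∘ f)
    (fun _ _ => Finset.mem_univ _) (fun f hf g hg h => ?_) (fun u _ => ?_) (fun f _ => ?_)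
  · exact hS.injOn (by simpa using hf) (by simpa using hg) h
  · obtain ⟨f, hf, rfl⟩ := hS.surjOn (Set.mem_univ u)
    exact ⟨f, by simpa using hf, rfl⟩
  · refine Finset.prod_congr rfl fun i _ => ?_
    rcases hfi : f i with z | b <;> simp [hw, hfi, letterWeight]

theorem ColorShatters.filter {ι Z : Type} {S : Set (ι → Z ⊕ Bool)} {I : Finset ι} {ε : ι → Bool}
    (h : ColorShatters S I ε) (b : Bool) :
    ColorShatters S (I.filter fun i => ε i = b) fun _ => b := by
  intro g hg
  obtain ⟨f, hf, hfg⟩ := h (fun i => if ε i = b then g i else Sum.inr (ε i)) fun i hi => by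
    by_cases hb : ε i = b
    · simpa [hb] using hg i (by simp [hi, hb])
    · simp [hb]
  refine ⟨f, hf, fun i hi => ?_⟩
  obtain ⟨hi, hb⟩ := Finset.mem_filter.1 hi
  simpa [hb] using hfg i hi

theorem exists_colorShatters_card_ge {Z : Type} [Fintype Z] {n : ℕ} {S : Set (Fin n → Z ⊕ Bool)}
    (hS : Set.BijOn
      (fun f => (Sum.elim (fun z => (some z : Option Z)) fun _ => (none : Option Z)) ∘ f)
      S Set.univ) :
    ∃ I ε, ColorShatters S I ε ∧
      n * Real.log (((Fintype.card Z : ℝ) + 1 / 2) / ((Fintype.card Z : ℝ) + 1 / 4)) ≤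
        I.card * Real.log 4 := by
  classical
  obtain ⟨f₀, hf₀, -⟩ := hS.surjOn (Set.mem_univ fun _ => none)
  obtain ⟨p, hp, hmax⟩ := Finset.exists_max_image
    (Finset.univ.filter fun p : Finset (Fin n) × (Fin n → Bool) => ColorShatters S p.1 p.2)
    (fun p => p.1.card)
    ⟨(∅, fun _ => false), by
      simp only [Finset.mem_filter, Finset.mem_univ, true_and]
      exact fun _ _ => ⟨f₀, hf₀, by simp⟩⟩
  refine ⟨p.1, p.2, by simpa using hp, ?_⟩
  have hle := weight_le_of_colorShatters_card_le S p.1.card fun I ε h =>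
    hmax (I, ε) (by simpa using h)
  rw [weight_eq_of_bijOn hS] at hle
  have hpos : (0 : ℝ) < (Fintype.card Z : ℝ) + 1 / 4 := by positivity
  rw [← Real.log_pow, ← Real.log_pow, div_pow]
  refine Real.log_le_log (by positivity) ?_
  rw [div_le_iff₀ (by positivity), mul_comm]
  exact hle


/-- Lemma on decompositions (`L-decomposition E combinatorics`).
The alphabet `Z ∪ {1,2}` is modelled by `Z ⊕ Bool`, with `Sum.inr false`
playing the role of `1` and `Sum.inr true` the role of `2`; the alphabet
`Z ∪ {3}` is modelled by `Option Z`, with `none` playing the role of `3`.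
The map `Γ_n` converts the coordinate values `1` and `2` to `3`, leaving
values in `Z` unchanged.  `S|_I ⊇ (Z ∪ {1})^I` means that every function
on `{1,…,n}` avoiding the value `2` on `I` agrees on `I` with some member
of `S`, and similarly for `(Z ∪ {2})^I`. -/
theorem stmt1 (Z : Type) [Fintype Z] :
    ∃ c : ℝ, 0 < c ∧
      ∀ (n : ℕ) (S : Set (Fin n → Z ⊕ Bool)),
        Set.BijOn
          (fun f => (Sum.elim (fun z => (some z : Option Z)) fun _ => (none : Option Z)) ∘ f)
          S Set.univ →
        ∃ I : Finset (Fin n), c * (n : ℝ) ≤ (I.card : ℝ) ∧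
          ((∀ g : Fin n → Z ⊕ Bool, (∀ i ∈ I, g i ≠ Sum.inr true) →
              ∃ f ∈ S, ∀ i ∈ I, f i = g i) ∨
            (∀ g : Fin n → Z ⊕ Bool, (∀ i ∈ I, g i ≠ Sum.inr false) →
              ∃ f ∈ S, ∀ i ∈ I, f i = g i)) := by
  have hpos : (0 : ℝ) < (Fintype.card Z : ℝ) + 1 / 4 := by positivity
  have h4 : 0 < Real.log 4 := Real.log_pos (by norm_num)
  refine ⟨Real.log (((Fintype.card Z : ℝ) + 1 / 2) / ((Fintype.card Z : ℝ) + 1 / 4)) /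
    (2 * Real.log 4), ?_, fun n S hS => ?_⟩
  · refine div_pos (Real.log_pos ?_) (by positivity)
    rw [one_lt_div hpos]
    linarith
  · obtain ⟨I, ε, hI, hcard⟩ := exists_colorShatters_card_ge hS
    have hhalf : ∃ b, (I.card : ℝ) ≤ 2 * (I.filter fun i => ε i = b).card := by
      have hsplit := Finset.card_filter_add_card_filter_not (s := I) fun i => ε i = true
      simp only [Bool.not_eq_true] at hsplit
      by_contra! hlt
      have h1 := hlt true
      have h2 := hlt false
      rw [← hsplit] at h1 h2
      push_cast at h1 h2
      linarith
    obtain ⟨b, hb⟩ := hhalf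
    refine ⟨I.filter fun i => ε i = b, ?_, ?_⟩
    · rw [div_mul_eq_mul_div, div_le_iff₀ (by positivity)]
      have := mul_le_mul_of_nonneg_right hb h4.le
      linarith
    · cases b
      · exact Or.inl (hI.filter false)
      · exact Or.inr (hI.filter true)
end

section
/- Let k ≥ 2, let U_1, …, U_k be pairwise disjoint subsets of X, and set 𝒰 = {U_1^c, …, U_k^c} (a cover of X). Then the tuple (U_1, …, U_k) has an independence set of positive density if and only if h_c(T, 𝒰) > 0. -/
open Filter Set

/-- `J ⊆ ℕ` is an independence set for the tuple `A = (A 0, …, A (k-1))` of subsets of `X`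
with respect to the map `T`. -/
def IsIndepSet {X : Type*} (T : X → X) {k : ℕ} (A : Fin k → Set X) (J : Set ℕ) : Prop :=
  ∀ I : Finset ℕ, I.Nonempty → ↑I ⊆ J → ∀ σ : ℕ → Fin k,
    (⋂ s ∈ I, T^[s] ⁻¹' A (σ s)).Nonempty

/-- `J ⊆ ℕ` has positive density: the limit of `|J ∩ {0,…,n}| / (n+1)` exists and is nonzero. -/
def HasPosDensity (J : Set ℕ) : Prop :=
  ∃ d : ℝ, d ≠ 0 ∧
    Tendsto (fun n : ℕ => (Nat.card (J ∩ Set.Iic n : Set ℕ) : ℝ) / (n + 1)) atTop (nhds d)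

/-- The tuple `A` has an independence set of positive density. -/
def HasIndepSetPosDensity {X : Type*} (T : X → X) {k : ℕ} (A : Fin k → Set X) : Prop :=
  ∃ J : Set ℕ, IsIndepSet T A J ∧ HasPosDensity J

/-- `x` is an IE-tuple: every product neighbourhood of `x` has an independence set of
positive density. -/
def IsIETuple {X : Type*} [TopologicalSpace X] (T : X → X) {k : ℕ} (x : Fin k → X) : Prop :=
  ∀ U : Fin k → Set X, (∀ i, IsOpen (U i)) → (∀ i, x i ∈ U i) →
    HasIndepSetPosDensity T U

/-- `covNumCompl T U n` is `N(𝒰 ∨ T⁻¹𝒰 ∨ ⋯ ∨ T^{-n+1}𝒰)`, the minimal cardinality of a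
subcover, where `𝒰 = {(U 0)ᶜ, …, (U (k-1))ᶜ}` is the cover of `X` by the complements of
the sets `U i`. -/
noncomputable def covNumCompl {X : Type*} (T : X → X) {k : ℕ} (U : Fin k → Set X)
    (n : ℕ) : ℕ :=
  sInf {m : ℕ | ∃ F : Finset (Fin n → Fin k), F.card = m ∧
    (⋃ σ ∈ F, ⋂ i : Fin n, T^[(i : ℕ)] ⁻¹' (U (σ i))ᶜ) = Set.univ}

section Independence

variable {X : Type*} {k : ℕ}

/-- `W` is shattered by `A` on `S`: every pattern of indices on `W` is realised by a point
of `S`. -/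
def Shatters (A : ℕ → Fin k → Set X) (S : Set X) (W : Finset ℕ) : Prop :=
  ∀ σ : ℕ → Fin k, ∃ x ∈ S, ∀ i ∈ W, x ∈ A i (σ i)

lemma Shatters.mono {A : ℕ → Fin k → Set X} {S S' : Set X} {W W' : Finset ℕ}
    (h : Shatters A S W) (hS : S ⊆ S') (hW : W' ⊆ W) : Shatters A S' W' := fun σ => by
  obtain ⟨x, hx, h⟩ := h σ
  exact ⟨x, hS hx, fun i hi => h i (hW hi)⟩

open Classical in
/-- The subsets of `{0, …, n - 1}` shattered by `A` on `S`. -/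
noncomputable def shatteredSets (A : ℕ → Fin k → Set X) (S : Set X) (n : ℕ) :
    Finset (Finset ℕ) :=
  (Finset.range n).powerset.filter (Shatters A S)

lemma mem_shatteredSets {A : ℕ → Fin k → Set X} {S : Set X} {n : ℕ} {W : Finset ℕ} :
    W ∈ shatteredSets A S n ↔ W ⊆ Finset.range n ∧ Shatters A S W := by
  simp [shatteredSets]

/-- Among the pieces `S ∩ A n j`, one shatters at most a proportion `(k - 1) / k` of the sets
shattered by `S`. -/
lemma exists_card_shatteredSets_le (hk : 2 ≤ k) (A : ℕ → Fin k → Set X) (S : Set X) (n : ℕ) :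
    ∃ j, k * (shatteredSets A (S ∩ A n j) n).card ≤
      (k - 1) * (shatteredSets A S (n + 1)).card := by
  classical
  have : Nonempty (Fin k) := ⟨⟨0, by omega⟩⟩
  set D : Fin k → Finset (Finset ℕ) := fun j => shatteredSets A (S ∩ A n j) n with hD
  set P := Finset.univ.biUnion D with hP
  set Q := P.filter (fun W => ∀ j, W ∈ D j) with hQ
  have hnW : ∀ W ∈ P, n ∉ W := by
    intro W hW hn
    obtain ⟨j, -, hj⟩ := Finset.mem_biUnion.1 hW
    simpa using (mem_shatteredSets.1 hj).1 hn
  have hQP : ∀ W ∈ Q, W ∈ P := fun W hW => (Finset.mem_filter.1 hW).1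
  have hcard : P.card + Q.card ≤ (shatteredSets A S (n + 1)).card := by
    have hinj : (Q.image (insert n)).card = Q.card := by
      refine Finset.card_image_of_injOn fun W hW W' hW' h => ?_
      have h' : insert n W = insert n W' := h
      rw [← Finset.erase_insert (hnW W (hQP W hW)), h',
        Finset.erase_insert (hnW W' (hQP W' hW'))]
    rw [← hinj, ← Finset.card_union_of_disjoint]
    · refine Finset.card_le_card fun W hW => ?_
      rcases Finset.mem_union.1 hW with hW | hW
      · obtain ⟨j, -, hj⟩ := Finset.mem_biUnion.1 hW
        obtain ⟨h1, h2⟩ := mem_shatteredSets.1 hj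
        exact mem_shatteredSets.2 ⟨h1.trans (Finset.range_mono (by omega)),
          h2.mono inter_subset_left subset_rfl⟩
      · obtain ⟨V, hV, rfl⟩ := Finset.mem_image.1 hW
        have hV' : ∀ j, V ∈ D j := (Finset.mem_filter.1 hV).2
        refine mem_shatteredSets.2 ⟨?_, fun σ => ?_⟩
        · have := (mem_shatteredSets.1 (hV' (Classical.arbitrary _))).1
          exact Finset.insert_subset (by simp) (this.trans (Finset.range_mono (by omega)))
        · obtain ⟨x, hx, h⟩ := (mem_shatteredSets.1 (hV' (σ n))).2 σ
          exact ⟨x, hx.1, Finset.forall_mem_insert _ _ _ |>.2 ⟨hx.2, h⟩⟩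
    · refine Finset.disjoint_left.2 fun W hW hW' => ?_
      obtain ⟨V, hV, rfl⟩ := Finset.mem_image.1 hW'
      exact hnW _ hW (Finset.mem_insert_self _ _)
  have hsum : ∑ j, (D j).card ≤ (k - 1) * (P.card + Q.card) := by
    have h1 : ∀ j, (D j).card = ∑ W ∈ P, if W ∈ D j then 1 else 0 := by
      intro j
      rw [← Finset.card_filter]
      congr 1
      ext W
      simp only [Finset.mem_filter, hP, Finset.mem_biUnion, Finset.mem_univ, true_and]
      exact ⟨fun h => ⟨⟨j, h⟩, h⟩, fun h => h.2⟩
    simp_rw [h1]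
    rw [Finset.sum_comm]
    have h2 : P.card + Q.card = ∑ W ∈ P, (1 + if ∀ j, W ∈ D j then 1 else 0) := by
      rw [Finset.sum_add_distrib, ← Finset.card_filter]
      simp [hQ]
    rw [h2, Finset.mul_sum]
    refine Finset.sum_le_sum fun W _ => ?_
    rw [← Finset.card_filter]
    split_ifs with h
    · have := Finset.card_filter_le (Finset.univ : Finset (Fin k)) (fun j => W ∈ D j)
      rw [Finset.card_univ, Fintype.card_fin] at this
      omega
    · push Not at h
      obtain ⟨j, hj⟩ := h
      have := Finset.card_lt_card (Finset.filter_ssubset (p := fun j => W ∈ D j).2 ⟨j, Finset.mem_univ _, hj⟩)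
      rw [Finset.card_univ, Fintype.card_fin] at this
      omega
  obtain ⟨j, -, hj⟩ := Finset.exists_min_image Finset.univ (fun j => (D j).card)
    Finset.univ_nonempty
  refine ⟨j, ?_⟩
  calc k * (D j).card = ∑ _i : Fin k, (D j).card := by simp
    _ ≤ ∑ i, (D i).card := Finset.sum_le_sum fun i hi => hj i hi
    _ ≤ _ := hsum.trans (Nat.mul_le_mul_left _ hcard)

/-- A set shattering few sets is covered by few cylinders avoiding the sets `A i j`. -/
lemma exists_cover_of_card_shatteredSets (hk : 2 ≤ k) (A : ℕ → Fin k → Set X)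
    (hA : ∀ n i j, i ≠ j → Disjoint (A n i) (A n j)) {t : ℝ} (ht : 0 < t) (ht1 : t ≤ 1)
    (n : ℕ) : ∀ (M : ℕ) (S : Set X),
      (shatteredSets A S n).card * (k - 1) ^ M < k ^ M →
      ∃ F : Finset (ℕ → Fin k), (F.card : ℝ) ≤ (t⁻¹) ^ M * (1 + t) ^ n ∧
        ∀ x ∈ S, ∃ τ ∈ F, ∀ i < n, x ∉ A i (τ i) := by
  classical
  have h1t : 1 ≤ t⁻¹ := (one_le_inv₀ ht).2 ht1
  have empty_of_zero : ∀ (n : ℕ) (S : Set X),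
      (shatteredSets A S n).card * (k - 1) ^ 0 < k ^ 0 → S = ∅ := by
    intro n S h
    by_contra hne
    obtain ⟨x, hx⟩ := nonempty_iff_ne_empty.2 hne
    have : ∅ ∈ shatteredSets A S n :=
      mem_shatteredSets.2 ⟨by simp, fun σ => ⟨x, hx, by simp⟩⟩
    have := Finset.card_pos.2 ⟨_, this⟩
    simp only [pow_zero, mul_one] at h
    omega
  induction n with
  | zero =>
    intro M S _
    refine ⟨{fun _ => ⟨0, by omega⟩}, ?_, fun x _ => by simp⟩
    simpa using one_le_pow₀ h1t
  | succ n ih =>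
    intro M S h
    cases M with
    | zero =>
      refine ⟨∅, by simp; positivity, ?_⟩
      simp [empty_of_zero _ _ h]
    | succ M =>
      obtain ⟨j, hj⟩ := exists_card_shatteredSets_le hk A S n
      obtain ⟨j', hj'⟩ : ∃ j' : Fin k, j ≠ j' := by
        have : Nontrivial (Fin k) := Fin.nontrivial_iff_two_le.2 hk
        obtain ⟨j', h⟩ := exists_ne j
        exact ⟨j', h.symm⟩
      obtain ⟨F, hF, hFc⟩ := ih (M + 1) S (lt_of_le_of_lt (Nat.mul_le_mul_right _
        (Finset.card_le_card fun W hW => by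
          obtain ⟨h1, h2⟩ := mem_shatteredSets.1 hW
          exact mem_shatteredSets.2 ⟨h1.trans (Finset.range_mono (by omega)), h2⟩)) h)
      obtain ⟨G, hG, hGc⟩ := ih M (S ∩ A n j) (by
        refine Nat.lt_of_mul_lt_mul_left (a := k) ?_
        calc k * ((shatteredSets A (S ∩ A n j) n).card * (k - 1) ^ M)
            = (k * (shatteredSets A (S ∩ A n j) n).card) * (k - 1) ^ M := by ring
          _ ≤ ((k - 1) * (shatteredSets A S (n + 1)).card) * (k - 1) ^ M :=
            Nat.mul_le_mul_right _ hj
          _ = (shatteredSets A S (n + 1)).card * (k - 1) ^ (M + 1) := by ring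
          _ < k ^ (M + 1) := h
          _ = k * k ^ M := by ring)
      refine ⟨F.image (fun τ => Function.update τ n j) ∪
        G.image (fun τ => Function.update τ n j'), ?_, fun x hx => ?_⟩
      · have h1 : (F.image (fun τ => Function.update τ n j) ∪
            G.image (fun τ => Function.update τ n j')).card ≤ F.card + G.card :=
          (Finset.card_union_le _ _).trans
            (add_le_add Finset.card_image_le Finset.card_image_le)
        have h2 : (t⁻¹) ^ (M + 1) * (1 + t) ^ (n + 1)
            = (t⁻¹) ^ (M + 1) * (1 + t) ^ n + (t⁻¹) ^ M * (1 + t) ^ n := by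
          have : t⁻¹ * t = 1 := inv_mul_cancel₀ ht.ne'
          linear_combination (t⁻¹) ^ M * (1 + t) ^ n * this
        rw [h2]
        refine le_trans ?_ (add_le_add hF hG)
        exact_mod_cast h1
      · have key : ∀ (τ : ℕ → Fin k) (l : Fin k), (∀ i < n, x ∉ A i (τ i)) → x ∉ A n l →
            ∀ i < n + 1, x ∉ A i (Function.update τ n l i) := by
          intro τ l h1 h2 i hi
          rcases Nat.lt_succ_iff_lt_or_eq.1 hi with h | rfl
          · rw [Function.update_of_ne h.ne]
            exact h1 i h
          · rwa [Function.update_self]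
        by_cases hxj : x ∈ A n j
        · obtain ⟨τ, hτ, h⟩ := hGc x ⟨hx, hxj⟩
          exact ⟨_, Finset.mem_union_right _ (Finset.mem_image_of_mem _ hτ),
            key τ j' h (disjoint_left.1 (hA n j j' hj') hxj)⟩
        · obtain ⟨τ, hτ, h⟩ := hFc x hx
          exact ⟨_, Finset.mem_union_left _ (Finset.mem_image_of_mem _ hτ), key τ j h hxj⟩

lemma card_le_of_forall_card_le {n m : ℕ} {P : Finset (Finset ℕ)}
    (hP : ∀ W ∈ P, W ⊆ Finset.range n) (hm : ∀ W ∈ P, W.card ≤ m) {s : ℝ} (hs : 0 < s)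
    (hs1 : s ≤ 1) : (P.card : ℝ) ≤ (s⁻¹) ^ m * (1 + s) ^ n := by
  have h1 : ∑ W ∈ (Finset.range n).powerset, s ^ W.card = (1 + s) ^ n := by
    have := Finset.sum_pow_mul_eq_add_pow s 1 (Finset.range n)
    simp only [one_pow, mul_one, Finset.card_range] at this
    rw [this, add_comm]
  have h2 : (P.card : ℝ) * s ^ m ≤ (1 + s) ^ n := by
    rw [← h1]
    calc (P.card : ℝ) * s ^ m = ∑ _W ∈ P, s ^ m := by simp
      _ ≤ ∑ W ∈ P, s ^ W.card :=
        Finset.sum_le_sum fun W hW => pow_le_pow_of_le_one hs.le hs1 (hm W hW)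
      _ ≤ _ := Finset.sum_le_sum_of_subset_of_nonneg
        (fun W hW => Finset.mem_powerset.2 (hP W hW)) fun _ _ _ => by positivity
  rw [inv_pow, mul_comm, ← div_eq_mul_inv, le_div_iff₀ (by positivity)]
  exact h2

/-- The sets `T⁻ⁱ (U j)`. -/
def pullback (T : X → X) (U : Fin k → Set X) (i : ℕ) (j : Fin k) : Set X := T^[i] ⁻¹' U j

/-- All finite subsets of `J` are independence sets, including the empty one. -/
def FinIndep (T : X → X) (U : Fin k → Set X) (J : Set ℕ) : Prop :=
  ∀ I : Finset ℕ, ↑I ⊆ J → Shatters (pullback T U) univ I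

lemma FinIndep.isIndepSet {T : X → X} {U : Fin k → Set X} {J : Set ℕ}
    (h : FinIndep T U J) : IsIndepSet T U J := fun I _ hI σ => by
  obtain ⟨x, -, hx⟩ := h I hI σ
  exact ⟨x, mem_iInter₂.2 hx⟩

lemma IsIndepSet.shatters {T : X → X} {U : Fin k → Set X} {J : Set ℕ}
    (h : IsIndepSet T U J) {I : Finset ℕ} (hne : I.Nonempty) (hI : ↑I ⊆ J) :
    Shatters (pullback T U) univ I := fun σ => by
  obtain ⟨x, hx⟩ := h I hne hI σ
  exact ⟨x, mem_univ x, mem_iInter₂.1 hx⟩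

lemma Shatters.finIndep {T : X → X} {U : Fin k → Set X} {W : Finset ℕ}
    (h : Shatters (pullback T U) univ W) : FinIndep T U (W : Set ℕ) :=
  fun _ hI => h.mono subset_rfl (by exact_mod_cast hI)

lemma FinIndep.shift {T : X → X} {U : Fin k → Set X} {J : Set ℕ} (h : FinIndep T U J)
    (s : ℕ) : FinIndep T U {i | s + i ∈ J} := fun I hI σ => by
  obtain ⟨x, -, hx⟩ := h (I.image (s + ·)) (by
    intro i hi
    obtain ⟨l, hl, rfl⟩ := Finset.mem_image.1 (Finset.mem_coe.1 hi)
    have hlJ : l ∈ {i | s + i ∈ J} := hI (Finset.mem_coe.2 hl)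
    exact hlJ) (fun i => σ (i - s))
  refine ⟨T^[s] x, mem_univ _, fun i hi => ?_⟩
  have := hx (s + i) (Finset.mem_image_of_mem _ hi)
  simp only [pullback, mem_preimage, Nat.add_sub_cancel_left] at this ⊢
  rwa [← Function.iterate_add_apply, add_comm i s]

/-- The maximal size of an independent subset of `{0, …, n - 1}`. -/
noncomputable def maxIndep (T : X → X) (U : Fin k → Set X) (n : ℕ) : ℕ :=
  (shatteredSets (pullback T U) univ n).sup Finset.card

open Classical in
lemma FinIndep.count_le {T : X → X} {U : Fin k → Set X} {J : Set ℕ} (h : FinIndep T U J)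
    (n : ℕ) : Nat.count (· ∈ J) n ≤ maxIndep T U n := by
  rw [Nat.count_eq_card_filter_range]
  refine Finset.le_sup (f := Finset.card) (mem_shatteredSets.2 ⟨Finset.filter_subset _ _, ?_⟩)
  exact h _ fun i hi => (Finset.mem_filter.1 (Finset.mem_coe.1 hi)).2

open Classical in
lemma exists_count_eq_maxIndep [Nonempty X] (T : X → X) (U : Fin k → Set X) (n : ℕ) :
    ∃ J : Set ℕ, FinIndep T U J ∧ Nat.count (· ∈ J) n = maxIndep T U n := by
  have hne : (shatteredSets (pullback T U) univ n).Nonempty :=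
    ⟨∅, mem_shatteredSets.2 ⟨by simp, fun σ => ⟨Classical.arbitrary X, by simp⟩⟩⟩
  obtain ⟨W, hW, h⟩ := Finset.exists_mem_eq_sup _ hne Finset.card
  obtain ⟨h1, h2⟩ := mem_shatteredSets.1 hW
  refine ⟨W, h2.finIndep, ?_⟩
  rw [maxIndep, h, Nat.count_eq_card_filter_range]
  congr 1
  ext i
  simpa using fun hi => by simpa using h1 hi

lemma subadditive_maxIndep [Nonempty X] (T : X → X) (U : Fin k → Set X) :
    Subadditive (fun n => (maxIndep T U n : ℝ)) := fun m n => by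
  classical
  obtain ⟨J, hJ, h⟩ := exists_count_eq_maxIndep T U (m + n)
  have h1 := hJ.count_le m
  have h2 := (hJ.shift m).count_le n
  rw [Nat.count_add] at h
  simp only [mem_ofPred_eq] at h2
  have h3 : maxIndep T U (m + n) ≤ maxIndep T U m + maxIndep T U n := by omega
  dsimp only
  exact_mod_cast h3

open Classical in
/-- A long set of density at least `d` has a shift all of whose initial segments, up to a
prescribed length, have density almost `d`. -/
lemma exists_shift_count_ge {J : Set ℕ} {d : ℝ} (hd : 0 ≤ d) {n N : ℕ}
    (hN : N = (n + 1) * (n + 2)) (hJ : d * N ≤ Nat.count (· ∈ J) N) :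
    ∃ s, ∀ t ≤ n, (d - 1 / (n + 1 : ℝ)) * t ≤ Nat.count (· ∈ {i | s + i ∈ J}) t := by
  set ε : ℝ := 1 / (n + 1 : ℝ) with hε
  obtain ⟨s, hs, hmin⟩ := Finset.exists_min_image (Finset.range (N + 1))
    (fun t => (Nat.count (· ∈ J) t : ℝ) - (d - ε) * t) ⟨0, by simp⟩
  have hsN : s ≤ N := by simpa [Nat.lt_succ_iff] using hs
  have hεpos : 0 < ε := by positivity
  have hεn : ε * (n + 1) = 1 := by rw [hε]; field_simp
  have h0 := hmin 0 (by simp)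
  simp only [Nat.count_zero, Nat.cast_zero, mul_zero, sub_zero] at h0
  have hlen : s + n ≤ N := by
    obtain ⟨r, rfl⟩ := Nat.exists_eq_add_of_le hsN
    rw [Nat.count_add] at hJ
    have h1 : Nat.count (fun i => s + i ∈ J) r ≤ r := Nat.count_le _
    have h1' : (Nat.count (fun i => s + i ∈ J) r : ℝ) ≤ r := by exact_mod_cast h1
    have hNr : ((s : ℝ) + r) = (n + 1) * (n + 2) := by exact_mod_cast hN
    push_cast at hJ
    have h2 : ε * (s + r) ≤ (1 + ε) * r := by nlinarith [(Nat.cast_nonneg r : (0 : ℝ) ≤ r)]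
    have h3 : (n + 2 : ℝ) ≤ (1 + ε) * r := by
      calc (n + 2 : ℝ) = ε * (n + 1) * (n + 2) := by rw [hεn]; ring
        _ = ε * (s + r) := by rw [hNr]; ring
        _ ≤ _ := h2
    have h4 : ((n : ℝ) + 2) * (n + 1) ≤ (n + 2) * r := by
      calc ((n : ℝ) + 2) * (n + 1) ≤ (1 + ε) * r * (n + 1) := by gcongr
        _ = (n + 1 + ε * (n + 1)) * r := by ring
        _ = _ := by rw [hεn]; ring
    have h5 : (n + 1 : ℝ) ≤ r := by
      refine le_of_mul_le_mul_left h4 (by positivity)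
    have : n + 1 ≤ r := by exact_mod_cast h5
    omega
  refine ⟨s, fun t ht => ?_⟩
  have h := hmin (s + t) (by simp; omega)
  rw [Nat.count_add] at h
  push_cast at h
  simp only [mem_ofPred_eq]
  linarith

open Classical in
/-- If the maximal density of finite independent sets is bounded below, there is an
independence set of positive density. -/
lemma hasIndepSetPosDensity_of_maxIndep [Nonempty X] (T : X → X) (U : Fin k → Set X) {c : ℝ}
    (hc : 0 < c) (h : ∀ᶠ n : ℕ in atTop, c * n ≤ maxIndep T U n) :
    HasIndepSetPosDensity T U := by
  have hsub := subadditive_maxIndep T U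
  have hbdd : BddBelow (range fun n : ℕ => (maxIndep T U n : ℝ) / n) :=
    ⟨0, by rintro _ ⟨n, rfl⟩; positivity⟩
  have hlim := hsub.tendsto_lim hbdd
  set d := hsub.lim with hd
  have hdpos : 0 < d := by
    refine hc.trans_le (ge_of_tendsto hlim ?_)
    filter_upwards [h, eventually_gt_atTop 0] with n hn h0
    rwa [le_div_iff₀ (by exact_mod_cast h0)]
  have hle : ∀ n : ℕ, d * n ≤ maxIndep T U n := by
    intro n
    rcases Nat.eq_zero_or_pos n with rfl | hn
    · simp
    · rw [← le_div_iff₀ (by exact_mod_cast hn)]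
      exact hsub.lim_le_div hbdd hn.ne'
  have hex : ∀ n : ℕ, ∃ J : Set ℕ, FinIndep T U J ∧
      ∀ t ≤ n, (d - 1 / (n + 1 : ℝ)) * t ≤ Nat.count (· ∈ J) t := by
    intro n
    obtain ⟨J, hJ, hJc⟩ := exists_count_eq_maxIndep T U ((n + 1) * (n + 2))
    obtain ⟨s, hs⟩ := exists_shift_count_ge hdpos.le (n := n) rfl (hJc ▸ hle _)
    exact ⟨_, hJ.shift s, hs⟩
  choose J hJ hJc using hex
  set K : Set ℕ := {i | ∀ᶠ n in (hyperfilter ℕ : Filter ℕ), i ∈ J n} with hK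
  have hKt : ∀ I : Finset ℕ, ∀ᶠ n in (hyperfilter ℕ : Filter ℕ), ∀ i ∈ I, (i ∈ J n ↔ i ∈ K) := by
    intro I
    rw [Filter.eventually_all_finset]
    intro i _
    by_cases hi : i ∈ K
    · filter_upwards [hi] with n hn
      simp [hn, hi]
    · have : ∀ᶠ n in (hyperfilter ℕ : Filter ℕ), ¬ i ∈ J n := Ultrafilter.eventually_not.2 hi
      filter_upwards [this] with n hn
      simp [hn, hi]
  have hat : (hyperfilter ℕ : Filter ℕ) ≤ atTop := Nat.hyperfilter_le_atTop
  have hKind : FinIndep T U K := by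
    intro I hI
    obtain ⟨n, hn⟩ := (hKt I).exists
    exact hJ n I fun i hi => (hn i hi).2 (hI hi)
  have hKlow : ∀ t : ℕ, d * t ≤ Nat.count (· ∈ K) t := by
    intro t
    have h1 : Tendsto (fun n : ℕ => (d - 1 / (n + 1 : ℝ)) * t) (hyperfilter ℕ : Filter ℕ)
        (nhds ((d - 0) * t)) :=
      ((tendsto_const_nhds.sub tendsto_one_div_add_atTop_nhds_zero_nat).mul_const _).mono_left hat
    rw [sub_zero] at h1
    refine le_of_tendsto h1 ?_
    filter_upwards [hKt (Finset.range t), hat (eventually_ge_atTop t)] with n hn htn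
    have : Nat.count (· ∈ J n) t = Nat.count (· ∈ K) t := by
      rw [Nat.count_eq_card_filter_range, Nat.count_eq_card_filter_range,
        Finset.filter_congr hn]
    rw [← this]
    exact hJc n t htn
  refine ⟨K, hKind.isIndepSet, d, hdpos.ne', ?_⟩
  have hcard : ∀ n : ℕ, Nat.card (K ∩ Iic n : Set ℕ) = Nat.count (· ∈ K) (n + 1) := by
    intro n
    rw [Nat.count_eq_card_filter_range, ← Nat.card_eq_finsetCard]
    congr 2
    ext i
    simp [and_comm]
  have hup := hlim.comp (tendsto_add_atTop_nat 1)
  refine tendsto_of_tendsto_of_tendsto_of_le_of_le tendsto_const_nhds hup (fun n => ?_)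
    fun n => ?_
  · simp only [hcard]
    rw [le_div_iff₀ (by positivity)]
    exact_mod_cast hKlow (n + 1)
  · simp only [hcard, Function.comp]
    push_cast
    gcongr
    exact hKind.count_le (n + 1)

/-- The cylinders indexed by `F` cover `X`. -/
def IsCylCover (T : X → X) (U : Fin k → Set X) {n : ℕ} (F : Finset (Fin n → Fin k)) : Prop :=
  ∀ x, ∃ σ ∈ F, ∀ i : Fin n, T^[(i : ℕ)] x ∉ U (σ i)

lemma isCylCover_iff {T : X → X} {U : Fin k → Set X} {n : ℕ} {F : Finset (Fin n → Fin k)} :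
    (⋃ σ ∈ F, ⋂ i : Fin n, T^[(i : ℕ)] ⁻¹' (U (σ i))ᶜ) = univ ↔ IsCylCover T U F := by
  simp [eq_univ_iff_forall, IsCylCover]

lemma covNumCompl_le {T : X → X} {U : Fin k → Set X} {n : ℕ} {F : Finset (Fin n → Fin k)}
    (hF : IsCylCover T U F) : covNumCompl T U n ≤ F.card :=
  Nat.sInf_le ⟨F, rfl, isCylCover_iff.2 hF⟩

lemma exists_card_eq_covNumCompl (hk : 2 ≤ k) (T : X → X) {U : Fin k → Set X}
    (hdisj : ∀ i j, i ≠ j → Disjoint (U i) (U j)) (n : ℕ) :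
    ∃ F : Finset (Fin n → Fin k), F.card = covNumCompl T U n ∧ IsCylCover T U F := by
  have hne : {m : ℕ | ∃ F : Finset (Fin n → Fin k), F.card = m ∧
      (⋃ σ ∈ F, ⋂ i : Fin n, T^[(i : ℕ)] ⁻¹' (U (σ i))ᶜ) = univ}.Nonempty := by
    refine ⟨_, Finset.univ, rfl, isCylCover_iff.2 fun x => ?_⟩
    have h : ∀ y : X, ∃ j, y ∉ U j := by
      intro y
      by_contra! h
      exact disjoint_left.1 (hdisj ⟨0, by omega⟩ ⟨1, by omega⟩ (by simp)) (h _) (h _)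
    choose f hf using h
    exact ⟨fun i => f (T^[(i : ℕ)] x), Finset.mem_univ _, fun i => hf _⟩
  obtain ⟨F, hF, h⟩ := Nat.sInf_mem hne
  exact ⟨F, hF, isCylCover_iff.1 h⟩

lemma covNumCompl_pos [Nonempty X] (hk : 2 ≤ k) (T : X → X) {U : Fin k → Set X}
    (hdisj : ∀ i j, i ≠ j → Disjoint (U i) (U j)) (n : ℕ) : 0 < covNumCompl T U n := by
  obtain ⟨F, hF, h⟩ := exists_card_eq_covNumCompl hk T hdisj n
  obtain ⟨σ, hσ, -⟩ := h (Classical.arbitrary X)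
  exact hF ▸ Finset.card_pos.2 ⟨σ, hσ⟩

lemma covNumCompl_add_le (hk : 2 ≤ k) (T : X → X) {U : Fin k → Set X}
    (hdisj : ∀ i j, i ≠ j → Disjoint (U i) (U j)) (m n : ℕ) :
    covNumCompl T U (m + n) ≤ covNumCompl T U m * covNumCompl T U n := by
  classical
  obtain ⟨F, hF, hFc⟩ := exists_card_eq_covNumCompl hk T hdisj m
  obtain ⟨G, hG, hGc⟩ := exists_card_eq_covNumCompl hk T hdisj n
  rw [← hF, ← hG]
  refine (covNumCompl_le (F := Finset.image₂ Fin.append F G) fun x => ?_).trans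
    (Finset.card_image₂_le _ _ _)
  obtain ⟨σ, hσ, h1⟩ := hFc x
  obtain ⟨τ, hτ, h2⟩ := hGc (T^[m] x)
  refine ⟨_, Finset.mem_image₂_of_mem hσ hτ, fun i => ?_⟩
  refine Fin.addCases (fun i => ?_) (fun i => ?_) i
  · simpa using h1 i
  · have := h2 i
    rw [← Function.iterate_add_apply] at this
    simpa [add_comm m] using this

lemma subadditive_log_covNumCompl [Nonempty X] (hk : 2 ≤ k) (T : X → X) {U : Fin k → Set X}
    (hdisj : ∀ i j, i ≠ j → Disjoint (U i) (U j)) :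
    Subadditive (fun n => Real.log (covNumCompl T U n)) := fun m n => by
  have hpos := fun n => (Nat.cast_pos (α := ℝ)).2 (covNumCompl_pos hk T hdisj n)
  rw [← Real.log_mul (hpos m).ne' (hpos n).ne']
  exact Real.log_le_log (hpos _) (by exact_mod_cast covNumCompl_add_le hk T hdisj m n)

/-- A shattered set `W` forces at least `(k / (k - 1)) ^ |W|` cylinders in every cover. -/
lemma Shatters.pow_le_card_mul {T : X → X} {U : Fin k → Set X} {W : Finset ℕ}
    (hk : 0 < k) (hW : Shatters (pullback T U) univ W) {n : ℕ} (hWn : W ⊆ Finset.range n)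
    {F : Finset (Fin n → Fin k)} (hF : IsCylCover T U F) :
    k ^ W.card ≤ F.card * (k - 1) ^ W.card := by
  classical
  have hlt : ∀ i : W, (i : ℕ) < n := fun i => Finset.mem_range.1 (hWn i.2)
  have hsub : (Finset.univ : Finset (W → Fin k)) ⊆ F.biUnion fun τ =>
      Fintype.piFinset fun i : W => Finset.univ.erase (τ ⟨i, hlt i⟩) := by
    intro σ _
    obtain ⟨x, -, hx⟩ := hW fun i => if h : i ∈ W then σ ⟨i, h⟩ else ⟨0, hk⟩
    obtain ⟨τ, hτ, h⟩ := hF x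
    refine Finset.mem_biUnion.2 ⟨τ, hτ, Fintype.mem_piFinset.2 fun i => ?_⟩
    refine Finset.mem_erase.2 ⟨fun heq => h ⟨i, hlt i⟩ ?_, Finset.mem_univ _⟩
    have := hx i i.2
    simp only [i.2, dif_pos, pullback, mem_preimage] at this
    rwa [← heq]
  have h1 := Finset.card_le_card hsub
  rw [Finset.card_univ, Fintype.card_fun, Fintype.card_fin, Fintype.card_coe] at h1
  refine h1.trans (Finset.card_biUnion_le_card_mul _ _ _ fun τ _ => ?_)
  rw [Fintype.card_piFinset]
  simp

/-- Upper bound for the covering numbers in terms of the largest independent sets. -/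
lemma log_covNumCompl_le [Nonempty X] (hk : 2 ≤ k) (T : X → X) {U : Fin k → Set X}
    (hdisj : ∀ i j, i ≠ j → Disjoint (U i) (U j)) {s t q : ℝ} (hs : 0 < s) (hs1 : s ≤ 1)
    (ht : 0 < t) (ht1 : t ≤ 1) (hq : 0 < q) (hqk : Real.exp q * (k - 1) = k) (n : ℕ) :
    Real.log (covNumCompl T U n) ≤
      ((maxIndep T U n * Real.log s⁻¹ + s * n) / q + 1) * Real.log t⁻¹ + t * n := by
  classical
  set P := shatteredSets (pullback T U) univ n with hP
  have hPpos : 0 < P.card := Finset.card_pos.2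
    ⟨∅, mem_shatteredSets.2 ⟨by simp, fun σ => ⟨Classical.arbitrary X, by simp⟩⟩⟩
  have hPpos' : (0 : ℝ) < P.card := by exact_mod_cast hPpos
  have hLt : 0 ≤ Real.log t⁻¹ := Real.log_nonneg ((one_le_inv₀ ht).2 ht1)
  have logbound : ∀ (u : ℝ), 0 < u → ∀ (m : ℕ) (c : ℕ), 0 < c →
      (c : ℝ) ≤ (u⁻¹) ^ m * (1 + u) ^ n → Real.log c ≤ m * Real.log u⁻¹ + u * n := by
    intro u hu m c hc h
    have h1 := Real.log_le_log (by exact_mod_cast hc) h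
    rw [Real.log_mul (by positivity) (by positivity), Real.log_pow, Real.log_pow] at h1
    have h2 : Real.log (1 + u) ≤ u := by
      have := Real.log_le_sub_one_of_pos (show 0 < 1 + u by positivity)
      linarith
    nlinarith [(Nat.cast_nonneg n : (0 : ℝ) ≤ n)]
  have hlogP : Real.log P.card ≤ maxIndep T U n * Real.log s⁻¹ + s * n :=
    logbound s hs _ _ hPpos (card_le_of_forall_card_le
      (fun W hW => (mem_shatteredSets.1 hW).1)
      (fun W hW => Finset.le_sup (f := Finset.card) hW) hs hs1)
  set M : ℕ := ⌊Real.log P.card / q⌋₊ + 1 with hM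
  have hlogP0 : 0 ≤ Real.log P.card := Real.log_natCast_nonneg _
  have hMle : (M : ℝ) ≤ Real.log P.card / q + 1 := by
    rw [hM]
    push_cast
    have := Nat.floor_le (div_nonneg hlogP0 hq.le)
    linarith
  have hMlt : Real.log P.card < M * q := by
    rw [← div_lt_iff₀ hq, hM]
    push_cast
    exact Nat.lt_floor_add_one _
  have hk1 : (0 : ℝ) < (k : ℝ) - 1 := by
    have : (2 : ℝ) ≤ k := by exact_mod_cast hk
    linarith
  have hPM : P.card * (k - 1) ^ M < k ^ M := by
    have h1 : (P.card : ℝ) < Real.exp q ^ M := by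
      rw [← Real.exp_nat_mul]
      exact (Real.log_lt_iff_lt_exp hPpos').1 hMlt
    have h2 : (P.card : ℝ) * (k - 1) ^ M < k ^ M := by
      calc (P.card : ℝ) * (k - 1) ^ M < Real.exp q ^ M * (k - 1) ^ M := by gcongr
        _ = k ^ M := by rw [← mul_pow, hqk]
    have h3 : ((k - 1 : ℕ) : ℝ) = k - 1 := by
      rw [Nat.cast_sub (by omega)]
      simp
    rw [← h3] at h2
    exact_mod_cast h2
  obtain ⟨F, hF, hFc⟩ := exists_cover_of_card_shatteredSets hk (pullback T U)
    (fun m i j hij => (hdisj i j hij).preimage _) ht ht1 n M univ hPM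
  have hcov : covNumCompl T U n ≤ F.card := by
    refine (covNumCompl_le (F := F.image fun τ (i : Fin n) => τ i) fun x => ?_).trans
      Finset.card_image_le
    obtain ⟨τ, hτ, h⟩ := hFc x (mem_univ x)
    exact ⟨_, Finset.mem_image_of_mem _ hτ, fun i => h i i.2⟩
  have h1 := logbound t ht M _ (covNumCompl_pos hk T hdisj n)
    (le_trans (by exact_mod_cast hcov) hF)
  have h2 : (M : ℝ) ≤ (maxIndep T U n * Real.log s⁻¹ + s * n) / q + 1 :=
    hMle.trans (by gcongr)
  exact h1.trans (by gcongr)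

end Independence

/-- Lemma `L-E vs IE`.  The combinatorial entropy `h_c(T, 𝒰)` of the cover
`𝒰 = {U_1ᶜ, …, U_kᶜ}` is the limit of `(1/n) log N(𝒰 ∨ ⋯ ∨ T^{-n+1}𝒰)`, so
`h_c(T, 𝒰) > 0` is expressed by the existence of a positive limit. -/
theorem stmt3 {X : Type*} [TopologicalSpace X] [CompactSpace X] [T2Space X]
    (T : X → X) (hT : Continuous T) (hTsurj : Function.Surjective T)
    {k : ℕ} (hk : 2 ≤ k) (U : Fin k → Set X)
    (hdisj : ∀ i j, i ≠ j → Disjoint (U i) (U j)) :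
    HasIndepSetPosDensity T U ↔
      ∃ h : ℝ, 0 < h ∧
        Tendsto (fun n : ℕ => Real.log (covNumCompl T U n : ℝ) / n) atTop (nhds h) := by
  classical
  have hk1 : (0 : ℝ) < (k : ℝ) - 1 := by
    have : (2 : ℝ) ≤ k := by exact_mod_cast hk
    linarith
  obtain ⟨q, hq, hqk⟩ : ∃ q : ℝ, 0 < q ∧ Real.exp q * (k - 1) = k := by
    have h1 : 1 < (k : ℝ) / (k - 1) := by
      rw [one_lt_div hk1]
      linarith
    refine ⟨Real.log (k / (k - 1)), Real.log_pos h1, ?_⟩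
    rw [Real.exp_log (by linarith)]
    field_simp
  constructor
  · rintro ⟨J, hJ, d, hd, hlim⟩
    have hd0 : 0 < d := lt_of_le_of_ne (ge_of_tendsto' hlim fun n => by positivity) hd.symm
    have hX : Nonempty X := by
      by_contra hX
      have hJe : J = ∅ := by
        refine eq_empty_of_forall_notMem fun i hi => hX ?_
        obtain ⟨x, -⟩ := hJ {i} (by simp) (by simpa using hi) fun _ => ⟨0, by omega⟩
        exact ⟨x⟩
      refine hd (tendsto_nhds_unique hlim ?_)
      simp [hJe]
    have hsub := subadditive_log_covNumCompl hk T hdisj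
    have hbdd : BddBelow (range fun n : ℕ => Real.log (covNumCompl T U n) / n) :=
      ⟨0, by
        rintro _ ⟨n, rfl⟩
        exact div_nonneg (Real.log_natCast_nonneg _) (Nat.cast_nonneg n)⟩
    have hconv := hsub.tendsto_lim hbdd
    refine ⟨hsub.lim, (mul_pos hd0 hq).trans_le ?_, hconv⟩
    refine le_of_tendsto_of_tendsto' (hlim.mul_const q)
      (hconv.comp (tendsto_add_atTop_nat 1)) fun n => ?_
    have hfin : (J ∩ Iic n).Finite := (finite_Iic n).inter_of_right J
    set W := hfin.toFinset with hW
    have hcard : Nat.card (J ∩ Iic n : Set ℕ) = W.card :=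
      Nat.card_eq_card_finite_toFinset hfin
    have hWJ : (W : Set ℕ) ⊆ J := by
      rw [hW, Finite.coe_toFinset]
      exact inter_subset_left
    have hWn : W ⊆ Finset.range (n + 1) := by
      intro i hi
      have := ((Finite.mem_toFinset hfin).1 hi).2
      simp only [mem_Iic] at this
      exact Finset.mem_range.2 (by omega)
    have hWs : Shatters (pullback T U) univ W := by
      rcases W.eq_empty_or_nonempty with h | h
      · rw [h]
        exact fun σ => ⟨Classical.arbitrary X, by simp⟩
      · exact hJ.shatters h hWJ
    obtain ⟨F, hF, hFc⟩ := exists_card_eq_covNumCompl hk T hdisj (n + 1)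
    have h1 := hWs.pow_le_card_mul (by omega) hWn hFc
    have h2 : (k : ℝ) ^ W.card ≤ covNumCompl T U (n + 1) * ((k : ℝ) - 1) ^ W.card := by
      have h3 : ((k - 1 : ℕ) : ℝ) = k - 1 := by
        rw [Nat.cast_sub (by omega)]
        simp
      rw [← hF, ← h3]
      exact_mod_cast h1
    have h4 : Real.exp q ^ W.card ≤ covNumCompl T U (n + 1) := by
      refine le_of_mul_le_mul_right ?_ (pow_pos hk1 W.card)
      rwa [← mul_pow, hqk]
    have h5 : W.card * q ≤ Real.log (covNumCompl T U (n + 1)) := by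
      rw [← Real.exp_nat_mul] at h4
      exact (Real.le_log_iff_exp_le
        (by exact_mod_cast covNumCompl_pos hk T hdisj (n + 1))).2 h4
    simp only [Function.comp, hcard]
    push_cast
    rw [div_mul_eq_mul_div]
    gcongr
  · rintro ⟨h, hh, hlim⟩
    have hX : Nonempty X := by
      by_contra hX
      rw [not_nonempty_iff] at hX
      have h0 : ∀ n, covNumCompl T U n = 0 := fun n =>
        Nat.le_zero.1 (covNumCompl_le (F := ∅) fun x => isEmptyElim x)
      simp only [h0, Nat.cast_zero, Real.log_zero, zero_div] at hlim
      exact hh.ne (tendsto_nhds_unique tendsto_const_nhds hlim)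
    set t : ℝ := min (h / 8) (1 / 2) with ht
    have htpos : 0 < t := lt_min (by positivity) (by norm_num)
    have ht1 : t < 1 := (min_le_right _ _).trans_lt (by norm_num)
    set L := Real.log t⁻¹ with hL
    have hLpos : 0 < L := Real.log_pos ((one_lt_inv₀ htpos).2 ht1)
    set s : ℝ := min (q * h / (8 * L)) (1 / 2) with hs
    have hspos : 0 < s := lt_min (by positivity) (by norm_num)
    have hs1 : s < 1 := (min_le_right _ _).trans_lt (by norm_num)
    have hsL : s / q * L ≤ h / 8 := by
      calc s / q * L ≤ q * h / (8 * L) / q * L := by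
            gcongr
            exact min_le_left _ _
        _ = h / 8 := by field_simp
    have hlogs : 0 < Real.log s⁻¹ := Real.log_pos ((one_lt_inv₀ hspos).2 hs1)
    set B := Real.log s⁻¹ / q * L with hB
    have hBpos : 0 < B := by positivity
    refine hasIndepSetPosDensity_of_maxIndep T U (c := h / (8 * B)) (by positivity) ?_
    have hlin : ∀ᶠ n : ℕ in atTop, L ≤ h / 8 * n :=
      (tendsto_natCast_atTop_atTop.const_mul_atTop (by positivity)).eventually_ge_atTop L
    filter_upwards [hlim.eventually (lt_mem_nhds (half_lt_self hh)), hlin,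
      eventually_gt_atTop 0] with n hn hnL hn0
    have hn0' : (0 : ℝ) < n := by exact_mod_cast hn0
    rw [lt_div_iff₀ hn0'] at hn
    have hmain := log_covNumCompl_le hk T hdisj hspos hs1.le htpos ht1.le hq hqk n
    have heq : ((maxIndep T U n * Real.log s⁻¹ + s * n) / q + 1) * L + t * n =
        maxIndep T U n * B + s / q * L * n + L + t * n := by
      rw [hB]
      ring
    rw [← hL, heq] at hmain
    have h1 : s / q * L * n ≤ h / 8 * n := by gcongr
    have h2 : t * n ≤ h / 8 * n := by
      gcongr
      exact min_le_left _ _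
    have h3 : h / 8 * n ≤ maxIndep T U n * B := by linarith
    calc h / (8 * B) * n = h / 8 * n / B := by field_simp
      _ ≤ _ := by rwa [div_le_iff₀ hBpos]
end

section
/- Let f ∈ C(X). Then f has an ℓ1-isomorphism set of positive density if and only if there exists an IE-pair (x, y) with f(x) ≠ f(y). -/
open Filter Set

/-- The cube with sides `h` (no constraint where `h` is `none`) is shattered by `S`. -/
def IsShatteredCube {ι L : Type*} (S : Finset (ι → L)) (h : ι → Option (L × L)) : Prop :=
  ∀ σ : ι → Bool, ∃ w ∈ S, ∀ z, ∀ q ∈ h z, w z = bif σ z then q.1 else q.2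

open Classical in
/-- The cubes shattered by `S` all of whose sides lie in `E`. -/
noncomputable def shatteredCubes {ι L : Type*} [Fintype ι] [Fintype L] (E : Set (L × L))
    (S : Finset (ι → L)) : Finset (ι → Option (L × L)) :=
  {h | IsShatteredCube S h ∧ ∀ z, ∀ q ∈ h z, q ∈ E}

section Cubes

variable {ι L : Type*} [Fintype ι] [Fintype L] {E : Set (L × L)}

lemma mem_shatteredCubes {S : Finset (ι → L)} {h : ι → Option (L × L)} :
    h ∈ shatteredCubes E S ↔ IsShatteredCube S h ∧ ∀ z, ∀ q ∈ h z, q ∈ E := by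
  simp [shatteredCubes]

lemma shatteredCubes_mono {S S' : Finset (ι → L)} (hS : S ⊆ S') :
    shatteredCubes E S ⊆ shatteredCubes E S' := by
  intro h hh
  rw [mem_shatteredCubes] at hh ⊢
  refine ⟨fun σ => ?_, hh.2⟩
  obtain ⟨w, hw, hw'⟩ := hh.1 σ
  exact ⟨w, hS hw, hw'⟩

lemma eq_none_of_mem_shatteredCubes (hE : ∀ q ∈ E, q.1 ≠ q.2) {S : Finset (ι → L)} {z : ι} {a : L}
    (ha : ∀ w ∈ S, w z = a) {h : ι → Option (L × L)} (hh : h ∈ shatteredCubes E S) :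
    h z = none := by
  rw [mem_shatteredCubes] at hh
  by_contra hz
  obtain ⟨q, hq⟩ := Option.ne_none_iff_exists'.1 hz
  obtain ⟨w, hw, hw'⟩ := hh.1 fun _ => true
  obtain ⟨u, hu, hu'⟩ := hh.1 fun _ => false
  have h1 := hw' z q hq
  have h2 := hu' z q hq
  rw [ha w hw] at h1
  rw [ha u hu] at h2
  exact hE q (hh.2 z q hq) (by simpa using h1.symm.trans h2)

open Finset Classical in
/-- Splitting a family of words along two letters at one coordinate makes the number of
shattered cubes superadditive. -/
lemma card_shatteredCubes_add_le (hE : ∀ q ∈ E, q.1 ≠ q.2) (S : Finset (ι → L)) (z : ι)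
    {q : L × L} (hq : q ∈ E) :
    #(shatteredCubes E {w ∈ S | w z = q.1}) + #(shatteredCubes E {w ∈ S | w z = q.2}) ≤
      #(shatteredCubes E S) := by
  set A := shatteredCubes E {w ∈ S | w z = q.1} with hA
  set B := shatteredCubes E {w ∈ S | w z = q.2} with hB
  have hAz : ∀ h ∈ A, h z = none := fun h hh =>
    eq_none_of_mem_shatteredCubes hE (a := q.1) (by simp) hh
  have hBz : ∀ h ∈ B, h z = none := fun h hh =>
    eq_none_of_mem_shatteredCubes hE (a := q.2) (by simp) hh
  set g : (ι → Option (L × L)) → (ι → Option (L × L)) := fun h => Function.update h z (some q)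
    with hg
  have hinj : Set.InjOn g (A ∩ B : Finset _) := by
    intro h hh h' hh' heq
    simp only [coe_inter, Set.mem_inter_iff, mem_coe] at hh hh'
    funext i
    by_cases hi : i = z
    · rw [hi, hAz h hh.1, hAz h' hh'.1]
    · simpa [hg, hi] using congrFun heq i
  have hdisj : Disjoint (A ∪ B) ((A ∩ B).image g) := by
    rw [Finset.disjoint_right]
    intro h hh hh'
    obtain ⟨h', -, rfl⟩ := mem_image.1 hh
    have : g h' z = none := (mem_union.1 hh').elim (hAz _) (hBz _)
    simp [hg] at this
  rw [← card_union_add_card_inter, ← card_image_of_injOn hinj, ← Finset.card_union_of_disjoint hdisj]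
  refine Finset.card_le_card (union_subset (union_subset (shatteredCubes_mono (filter_subset _ _))
    (shatteredCubes_mono (filter_subset _ _))) ?_)
  intro h hh
  obtain ⟨h', hh', rfl⟩ := mem_image.1 hh
  rw [Finset.mem_inter, hA, hB, mem_shatteredCubes, mem_shatteredCubes] at hh'
  rw [mem_shatteredCubes]
  refine ⟨fun σ => ?_, fun i r hr => ?_⟩
  · have key : ∃ w ∈ S, w z = (bif σ z then q.1 else q.2) ∧
        ∀ i, ∀ r ∈ h' i, w i = bif σ i then r.1 else r.2 := by
      cases hσ : σ z with
      | true =>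
        obtain ⟨w, hw, hw'⟩ := hh'.1.1 σ
        rw [mem_filter] at hw
        exact ⟨w, hw.1, hw.2, hw'⟩
      | false =>
        obtain ⟨w, hw, hw'⟩ := hh'.2.1 σ
        rw [mem_filter] at hw
        exact ⟨w, hw.1, hw.2, hw'⟩
    obtain ⟨w, hw, hwz, hw'⟩ := key
    refine ⟨w, hw, fun i r hr => ?_⟩
    by_cases hi : i = z
    · subst hi
      have : q = r := by simpa [hg] using hr
      rw [hwz, this]
    · exact hw' i r (by simpa [hg, hi] using hr)
  · by_cases hi : i = z
    · subst hi
      have : q = r := by simpa [hg] using hr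
      exact this ▸ hq
    · exact hh'.1.2 i r (by simpa [hg, hi] using hr)

open Finset Classical in
/-- If every subfamily with at least two words splits into two proportional parts,
then the number of shattered cubes is polynomially large in the number of words. -/
lemma card_le_card_shatteredCubes_pow (hE : ∀ q ∈ E, q.1 ≠ q.2) {S₀ : Finset (ι → L)} {k : ℕ}
    (hsplit : ∀ S ⊆ S₀, 1 < #S → ∃ z, ∃ q ∈ E,
      #S ≤ 2 ^ k * #{w ∈ S | w z = q.1} ∧ #S ≤ 2 ^ k * #{w ∈ S | w z = q.2}) :
    ∀ S ⊆ S₀, #S ≤ #(shatteredCubes E S) ^ k := by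
  intro S
  induction S using Finset.strongInduction with
  | H S ih =>
    intro hS
    rcases Nat.lt_or_ge 1 #S with hS1 | hS1
    · obtain ⟨z, q, hq, h1, h2⟩ := hsplit S hS hS1
      have hne := hE q hq
      have hpos : ∀ m, #S ≤ 2 ^ k * m → 0 < m := by
        intro m hm
        rcases Nat.eq_zero_or_pos m with rfl | h
        · omega
        · exact h
      obtain ⟨u₁, hu₁⟩ := card_pos.1 (hpos _ h1)
      obtain ⟨u₂, hu₂⟩ := card_pos.1 (hpos _ h2)
      rw [mem_filter] at hu₁ hu₂
      have hs1 : {w ∈ S | w z = q.1} ⊂ S := by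
        refine filter_ssubset.2 ⟨u₂, hu₂.1, fun h => hne (h.symm.trans hu₂.2)⟩
      have hs2 : {w ∈ S | w z = q.2} ⊂ S := by
        refine filter_ssubset.2 ⟨u₁, hu₁.1, fun h => hne (hu₁.2.symm.trans h)⟩
      have i1 := ih _ hs1 (hs1.1.trans hS)
      have i2 := ih _ hs2 (hs2.1.trans hS)
      have hadd := card_shatteredCubes_add_le hE S z hq
      set c₁ := #(shatteredCubes E {w ∈ S | w z = q.1})
      set c₂ := #(shatteredCubes E {w ∈ S | w z = q.2})
      have main : ∀ c, #S ≤ 2 ^ k * c ^ k → 2 * c ≤ c₁ + c₂ →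
          #S ≤ #(shatteredCubes E S) ^ k := by
        intro c hc hc'
        rw [← mul_pow] at hc
        exact hc.trans (Nat.pow_le_pow_left (hc'.trans hadd) k)
      rcases le_total c₁ c₂ with h | h
      · exact main c₁ (h1.trans (Nat.mul_le_mul_left _ i1)) (by omega)
      · exact main c₂ (h2.trans (Nat.mul_le_mul_left _ i2)) (by omega)
    · rcases S.eq_empty_or_nonempty with rfl | ⟨w, hw⟩
      · simp
      · refine hS1.trans (Nat.one_le_pow _ _ (card_pos.2 ⟨fun _ => none, ?_⟩))
        rw [mem_shatteredCubes]
        exact ⟨fun σ => ⟨w, hw, by simp⟩, by simp⟩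

open Finset Classical in
/-- An exponential weight bounds the number of cubes with few constrained coordinates. -/
lemma card_le_exp_of_card_support_le {𝒞 : Finset (ι → Option (L × L))} {y m : ℝ} (hy : 0 ≤ y)
    (h𝒞 : ∀ h ∈ 𝒞, (#{z | h z ≠ none} : ℝ) ≤ m) :
    (#𝒞 : ℝ) ≤ Real.exp (y * m + Fintype.card ι * (Fintype.card L ^ 2 * Real.exp (-y))) := by
  set wt : Option (L × L) → ℝ := fun o => if o ≠ none then Real.exp (-y) else 1 with hwt
  have hprod : ∀ h : ι → Option (L × L),
      ∏ z, wt (h z) = Real.exp (-y) ^ #{z | h z ≠ none} := by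
    intro h
    simp only [hwt]
    rw [prod_ite]
    simp
  have hsum : ∑ h : ι → Option (L × L), ∏ z, wt (h z) =
      (1 + Fintype.card L ^ 2 * Real.exp (-y)) ^ Fintype.card ι := by
    rw [← Fintype.piFinset_univ, ← prod_univ_sum (fun _ => univ) (fun _ o => wt o)]
    simp [hwt, Fintype.sum_option, sq]
  have h1 : (#𝒞 : ℝ) * Real.exp (-(y * m)) ≤
      (1 + Fintype.card L ^ 2 * Real.exp (-y)) ^ Fintype.card ι := by
    rw [← hsum, ← nsmul_eq_mul, ← sum_const]
    calc ∑ _h ∈ 𝒞, Real.exp (-(y * m)) ≤ ∑ h ∈ 𝒞, ∏ z, wt (h z) := by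
          refine sum_le_sum fun h hh => ?_
          rw [hprod, ← Real.exp_nat_mul, Real.exp_le_exp]
          nlinarith [h𝒞 h hh]
      _ ≤ _ := sum_le_univ_sum_of_nonneg fun h => by rw [hprod]; positivity
  have h2 : (1 + Fintype.card L ^ 2 * Real.exp (-y)) ^ Fintype.card ι ≤
      Real.exp (Fintype.card ι * (Fintype.card L ^ 2 * Real.exp (-y))) := by
    rw [Real.exp_nat_mul]
    gcongr
    rw [add_comm]
    exact Real.add_one_le_exp _
  rw [Real.exp_add, mul_comm]
  rw [Real.exp_neg, ← div_eq_mul_inv, div_le_iff₀ (Real.exp_pos _)] at h1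
  exact h1.trans (by gcongr)

end Cubes

section Signs

variable {ι L : Type*} [Fintype ι] [Fintype L]

/-- The sign `±1` encoded by a boolean. -/
def boolSign (b : Bool) : ℝ := bif b then 1 else -1

open Finset Classical in
/-- Hoeffding's inequality for real Rademacher sums, in counting form. -/
lemma card_signs_le_real {r : ι → ℝ} {M ρ : ℝ} (hM : 0 < M) (hr : ∀ z, |r z| ≤ M) (hρ : 0 ≤ ρ) :
    (#{ε : ι → Bool | ρ * Fintype.card ι ≤ ∑ z, boolSign (ε z) * r z} : ℝ) ≤
      2 ^ Fintype.card ι * Real.exp (-(Fintype.card ι * (ρ ^ 2 / (2 * M ^ 2)))) := by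
  set n := Fintype.card ι
  set t := ρ / M ^ 2 with ht
  have ht0 : 0 ≤ t := by positivity
  have hsum : ∑ ε : ι → Bool, Real.exp (t * ∑ z, boolSign (ε z) * r z) =
      ∏ z, (2 * Real.cosh (t * r z)) := by
    simp_rw [mul_sum, Real.exp_sum]
    rw [← Fintype.piFinset_univ,
      ← prod_univ_sum (fun _ => univ) (fun z b => Real.exp (t * (boolSign b * r z)))]
    refine prod_congr rfl fun z _ => ?_
    rw [Real.cosh_eq]
    simp [boolSign]
    ring
  have hle : ∏ z, (2 * Real.cosh (t * r z)) ≤ 2 ^ n * Real.exp (n * (t ^ 2 * M ^ 2 / 2)) := by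
    rw [Real.exp_nat_mul, ← mul_pow]
    refine (prod_le_prod (fun z _ => by positivity) fun z _ => ?_).trans_eq (prod_const _)
    gcongr
    refine (Real.cosh_le_exp_half_sq _).trans (Real.exp_le_exp.2 ?_)
    rw [mul_pow]
    have : r z ^ 2 ≤ M ^ 2 := sq_le_sq' (abs_le.1 (hr z)).1 (abs_le.1 (hr z)).2
    gcongr
  have hlow : (#{ε : ι → Bool | ρ * n ≤ ∑ z, boolSign (ε z) * r z} : ℝ) * Real.exp (t * (ρ * n)) ≤
      ∑ ε : ι → Bool, Real.exp (t * ∑ z, boolSign (ε z) * r z) := by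
    rw [← nsmul_eq_mul, ← sum_const]
    refine (sum_le_sum fun ε hε => ?_).trans
      (sum_le_univ_sum_of_nonneg fun ε => (Real.exp_pos _).le)
    exact Real.exp_le_exp.2 (mul_le_mul_of_nonneg_left (mem_filter.1 hε).2 ht0)
  rw [hsum] at hlow
  have h := hlow.trans hle
  rw [← le_div_iff₀ (Real.exp_pos _), mul_div_assoc, ← Real.exp_sub] at h
  refine h.trans (le_of_eq ?_)
  congr 2
  rw [ht]
  field_simp
  ring

open Finset Classical in
/-- Hoeffding's inequality for complex Rademacher sums, in counting form. -/
lemma card_signs_le {u : ι → ℂ} {M τ : ℝ} (hM : 0 < M) (hu : ∀ z, ‖u z‖ ≤ M) (hτ : 0 ≤ τ) :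
    (#{ε : ι → Bool | τ * Fintype.card ι ≤ ‖∑ z, (boolSign (ε z) : ℂ) * u z‖} : ℝ) ≤
      4 * (2 ^ Fintype.card ι * Real.exp (-(Fintype.card ι * ((τ / 2) ^ 2 / (2 * M ^ 2))))) := by
  set n := Fintype.card ι
  set B := 2 ^ n * Real.exp (-(n * ((τ / 2) ^ 2 / (2 * M ^ 2))))
  let F : (ι → ℝ) → Finset (ι → Bool) := fun r => {ε | τ / 2 * n ≤ ∑ z, boolSign (ε z) * r z}
  have hre : ∀ z, |(u z).re| ≤ M := fun z => (Complex.abs_re_le_norm _).trans (hu z)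
  have him : ∀ z, |(u z).im| ≤ M := fun z => (Complex.abs_im_le_norm _).trans (hu z)
  have hF : ∀ r : ι → ℝ, (∀ z, |r z| ≤ M) → (#(F r) : ℝ) ≤ B := fun r hr =>
    card_signs_le_real hM hr (by positivity)
  have hsub : ({ε : ι → Bool | τ * n ≤ ‖∑ z, (boolSign (ε z) : ℂ) * u z‖} : Finset _) ⊆
      (F (fun z => (u z).re) ∪ F (fun z => -(u z).re)) ∪
        (F (fun z => (u z).im) ∪ F (fun z => -(u z).im)) := by
    intro ε hε
    have hε := (mem_filter.1 hε).2
    have h := hε.trans (Complex.norm_le_abs_re_add_abs_im _)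
    simp only [Complex.re_sum, Complex.im_sum, Complex.re_ofReal_mul, Complex.im_ofReal_mul] at h
    simp only [F, Finset.mem_union, mem_filter, Finset.mem_univ, true_and, mul_neg, sum_neg_distrib]
    by_contra! hcon
    obtain ⟨⟨h1, h2⟩, h3, h4⟩ := hcon
    have := abs_lt.2 ⟨by linarith, h1⟩
    have := abs_lt.2 ⟨by linarith, h3⟩
    linarith
  have hcard := (Finset.card_le_card hsub).trans ((Finset.card_union_le _ _).trans
    (add_le_add (Finset.card_union_le _ _) (Finset.card_union_le _ _)))
  have h1 := hF _ hre
  have h2 := hF (fun z => -(u z).re) (by simpa using hre)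
  have h3 := hF _ him
  have h4 := hF (fun z => -(u z).im) (by simpa using him)
  have hcard' : (#{ε : ι → Bool | τ * n ≤ ‖∑ z, (boolSign (ε z) : ℂ) * u z‖} : ℝ) ≤
      (#(F fun z => (u z).re) + #(F fun z => -(u z).re)) +
        (#(F fun z => (u z).im) + #(F fun z => -(u z).im)) := by exact_mod_cast hcard
  linarith

lemma norm_boolSign (b : Bool) : ‖(boolSign b : ℂ)‖ = 1 := by
  cases b <;> simp [boolSign]

open Finset Classical in
/-- A family of words whose sign sums are all large contains exponentially many words
which are pairwise far apart in the normalised `ℓ¹` distance. -/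
lemma exists_separated {v : L → ℂ} {M θ : ℝ} (hM : 0 < M) (hv : ∀ a, ‖v a‖ ≤ M) (hθ : 0 < θ)
    {S : Finset (ι → L)}
    (hS : ∀ ε : ι → Bool, ∃ w ∈ S,
      θ * Fintype.card ι ≤ ‖∑ z, (boolSign (ε z) : ℂ) * v (w z)‖) :
    ∃ S₀ ⊆ S, (∀ w ∈ S₀, ∀ w' ∈ S₀, w ≠ w' →
        θ / 2 * Fintype.card ι ≤ ∑ z, ‖v (w z) - v (w' z)‖) ∧
      Real.exp (Fintype.card ι * ((θ / 4) ^ 2 / (2 * M ^ 2))) ≤ 4 * #S₀ := by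
  set n := Fintype.card ι
  let sep : Finset (ι → L) → Prop := fun R => ∀ w ∈ R, ∀ w' ∈ R, w ≠ w' →
    θ / 2 * n ≤ ∑ z, ‖v (w z) - v (w' z)‖
  obtain ⟨S₀, hS₀⟩ := exists_maximal (s := {R ∈ S.powerset | sep R})
    ⟨∅, by simp [sep]⟩
  have hmem := hS₀.1
  simp only [mem_filter, Finset.mem_powerset] at hmem
  refine ⟨S₀, hmem.1, hmem.2, ?_⟩
  have hclose : ∀ w ∈ S, ∃ w' ∈ S₀, ∑ z, ‖v (w z) - v (w' z)‖ ≤ θ / 2 * n := by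
    intro w hw
    by_contra! hcon
    have hwS : w ∉ S₀ := fun h => by
      have := hcon w h
      simp only [sub_self, norm_zero, sum_const_zero] at this
      have : 0 ≤ θ / 2 * n := by positivity
      linarith
    have hins : insert w S₀ ∈ ({R ∈ S.powerset | sep R} : Finset _) := by
      simp only [mem_filter, Finset.mem_powerset]
      refine ⟨Finset.insert_subset hw hmem.1, ?_⟩
      intro a ha b hb hab
      rw [Finset.mem_insert] at ha hb
      rcases ha with rfl | ha <;> rcases hb with rfl | hb
      · exact absurd rfl hab
      · exact (hcon b hb).le
      · refine (hcon a ha).le.trans (le_of_eq (sum_congr rfl fun z _ => norm_sub_rev _ _))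
      · exact hmem.2 a ha b hb hab
    exact hwS (hS₀.2 hins (Finset.subset_insert _ _) (Finset.mem_insert_self _ _))
  let G : (ι → L) → Finset (ι → Bool) := fun w =>
    {ε | θ / 2 * n ≤ ‖∑ z, (boolSign (ε z) : ℂ) * v (w z)‖}
  have hcover : (univ : Finset (ι → Bool)) ⊆ S₀.biUnion G := by
    intro ε _
    obtain ⟨w, hw, hw'⟩ := hS ε
    obtain ⟨w₀, hw₀, hw₀'⟩ := hclose w hw
    rw [Finset.mem_biUnion]
    refine ⟨w₀, hw₀, ?_⟩
    simp only [G, mem_filter, Finset.mem_univ, true_and]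
    have hdiff : ‖∑ z, (boolSign (ε z) : ℂ) * v (w z) - ∑ z, (boolSign (ε z) : ℂ) * v (w₀ z)‖ ≤
        ∑ z, ‖v (w z) - v (w₀ z)‖ := by
      rw [← sum_sub_distrib]
      refine (norm_sum_le _ _).trans (le_of_eq (sum_congr rfl fun z _ => ?_))
      rw [← mul_sub, norm_mul, norm_boolSign, one_mul]
    have := norm_sub_norm_le (∑ z, (boolSign (ε z) : ℂ) * v (w z))
      (∑ z, (boolSign (ε z) : ℂ) * v (w₀ z))
    linarith
  have h1 : (2 : ℝ) ^ n ≤ #S₀ * (4 * (2 ^ n * Real.exp (-(n * ((θ / 4) ^ 2 / (2 * M ^ 2)))))) := by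
    have h2 : ((2 ^ n : ℕ) : ℝ) ≤ ∑ w ∈ S₀, (#(G w) : ℝ) := by
      have := (Finset.card_le_card hcover).trans card_biUnion_le
      simp only [card_univ, Fintype.card_fun, Fintype.card_bool] at this
      exact_mod_cast this
    push_cast at h2
    refine h2.trans ?_
    rw [← nsmul_eq_mul, ← sum_const]
    refine sum_le_sum fun w _ => ?_
    have := card_signs_le (u := fun z => v (w z)) hM (fun z => hv _) (half_pos hθ).le
    rwa [show θ / 2 / 2 = θ / 4 by ring] at this
  rw [Real.exp_neg] at h1
  have h3 : (0 : ℝ) < 2 ^ n := by positivity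
  have h4 := Real.exp_pos (n * ((θ / 4) ^ 2 / (2 * M ^ 2)))
  set e := Real.exp (n * ((θ / 4) ^ 2 / (2 * M ^ 2)))
  have h5 : (#S₀ : ℝ) * (4 * (2 ^ n * e⁻¹)) = 2 ^ n * (4 * #S₀ / e) := by
    field_simp
  rw [h5] at h1
  have h6 : 1 ≤ 4 * (#S₀ : ℝ) / e := by
    by_contra! hcon
    nlinarith
  rwa [one_le_div h4] at h6

open Finset Classical in
/-- A separated family of words splits proportionally along two far apart letters. -/
lemma exists_split_of_separated {v : L → ℂ} {M θ : ℝ} (hM : 0 < M) (hv : ∀ a, ‖v a‖ ≤ M)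
    (hθ : 0 < θ) {k : ℕ} (hk : 16 * M * Fintype.card L ^ 2 ≤ 2 ^ k * θ) {S : Finset (ι → L)}
    (hsep : ∀ w ∈ S, ∀ w' ∈ S, w ≠ w' →
        θ / 2 * Fintype.card ι ≤ ∑ z, ‖v (w z) - v (w' z)‖) (hS : 1 < #S) :
    ∃ z, ∃ q ∈ {q : L × L | θ / 8 ≤ ‖v q.1 - v q.2‖},
      #S ≤ 2 ^ k * #{w ∈ S | w z = q.1} ∧ #S ≤ 2 ^ k * #{w ∈ S | w z = q.2} := by
  obtain ⟨w₁, hw₁, w₂, -, hne⟩ := one_lt_card.1 hS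
  obtain ⟨z₀, -⟩ := Function.ne_iff.1 hne
  have hN : (2 : ℝ) ≤ #S := by exact_mod_cast hS
  have hKpos : 0 < Fintype.card L := Fintype.card_pos_iff.2 ⟨w₁ z₀⟩
  have hK : (0 : ℝ) < Fintype.card L := by exact_mod_cast hKpos
  set d : ι → (ι → L) × (ι → L) → ℝ := fun z p => ‖v (p.1 z) - v (p.2 z)‖ with hd
  have htotal : ∑ _z : ι, (#S : ℝ) ^ 2 * (θ / 4) ≤ ∑ z, ∑ p ∈ S ×ˢ S, d z p := by
    rw [sum_comm]
    have h1 : ∑ _p ∈ S.offDiag, θ / 2 * (Fintype.card ι : ℝ) ≤ ∑ p ∈ S ×ˢ S, ∑ z, d z p := by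
      refine (sum_le_sum fun p hp => ?_).trans (sum_le_sum_of_subset_of_nonneg
        (fun p hp => by rw [Finset.mem_offDiag] at hp; exact mk_mem_product hp.1 hp.2.1)
        fun p _ _ => sum_nonneg fun z _ => norm_nonneg _)
      rw [Finset.mem_offDiag] at hp
      exact hsep p.1 hp.1 p.2 hp.2.1 hp.2.2
    refine le_trans ?_ h1
    rw [sum_const, sum_const, offDiag_card, nsmul_eq_mul, nsmul_eq_mul, card_univ,
      Nat.cast_sub (Nat.le_mul_self _)]
    push_cast
    have hn : (0 : ℝ) ≤ Fintype.card ι := by positivity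
    have : (#S : ℝ) ^ 2 ≤ 2 * (#S * #S - #S) := by nlinarith
    nlinarith [mul_nonneg hn hθ.le]
  obtain ⟨z, -, hz⟩ := exists_le_of_sum_le ⟨z₀, Finset.mem_univ _⟩ htotal
  set far := {p ∈ S ×ˢ S | θ / 8 ≤ d z p} with hfar
  have hsum : ∑ p ∈ S ×ˢ S, d z p ≤ (#S : ℝ) ^ 2 * (θ / 8) + #far * (2 * M) := by
    have hpt : ∀ p ∈ S ×ˢ S, d z p ≤ θ / 8 + if θ / 8 ≤ d z p then 2 * M else 0 := by
      intro p _
      split_ifs with h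
      · have := norm_sub_le (v (p.1 z)) (v (p.2 z))
        have h1 := hv (p.1 z)
        have h2 := hv (p.2 z)
        simp only [hd]
        linarith
      · linarith
    refine (sum_le_sum hpt).trans (le_of_eq ?_)
    rw [sum_add_distrib, sum_const, ← sum_filter, sum_const, card_product, nsmul_eq_mul,
      nsmul_eq_mul, Nat.cast_mul, sq]
  set β := θ / (16 * M * Fintype.card L ^ 2) with hβ
  have hβ0 : 0 < β := by positivity
  have hβk : 1 ≤ 2 ^ k * β := by
    rw [hβ, ← mul_div_assoc, one_le_div (by positivity)]
    exact hk
  have hfarcard : (#S : ℝ) ^ 2 * (θ / (16 * M)) ≤ #far := by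
    rw [← mul_div_assoc, div_le_iff₀ (by positivity)]
    linarith
  obtain ⟨q, -, hq⟩ := exists_le_card_fiber_of_nsmul_le_card_of_maps_to (s := far)
    (t := (univ : Finset (L × L))) (f := fun p => (p.1 z, p.2 z)) (b := (#S : ℝ) ^ 2 * β)
    (fun _ _ => Finset.mem_univ _) ⟨(w₁ z, w₁ z), Finset.mem_univ _⟩ (by
      refine le_trans (le_of_eq ?_) hfarcard
      rw [nsmul_eq_mul, card_univ, Fintype.card_prod, hβ]
      push_cast
      field_simp)
  have hpos : (0 : ℝ) < #{p ∈ far | (p.1 z, p.2 z) = q} := lt_of_lt_of_le (by positivity) hq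
  have hqE : θ / 8 ≤ ‖v q.1 - v q.2‖ := by
    obtain ⟨p, hp⟩ := card_pos.1 (Nat.cast_pos.1 hpos)
    rw [mem_filter, hfar, mem_filter] at hp
    rw [← hp.2]
    exact hp.1.2
  have hsub : {p ∈ far | (p.1 z, p.2 z) = q} ⊆ {w ∈ S | w z = q.1} ×ˢ {w ∈ S | w z = q.2} := by
    intro p hp
    rw [mem_filter, hfar, mem_filter, mem_product] at hp
    obtain ⟨⟨⟨h1, h2⟩, -⟩, rfl⟩ := hp
    simp [h1, h2]
  have hprod : (#S : ℝ) ^ 2 * β ≤ #{w ∈ S | w z = q.1} * #{w ∈ S | w z = q.2} := by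
    have h := Finset.card_le_card hsub
    rw [card_product] at h
    exact hq.trans (by exact_mod_cast h)
  have ha : (#{w ∈ S | w z = q.1} : ℝ) ≤ #S := by exact_mod_cast card_filter_le _ _
  have hb : (#{w ∈ S | w z = q.2} : ℝ) ≤ #S := by exact_mod_cast card_filter_le _ _
  have hconc : ∀ a b : ℕ, (#S : ℝ) ^ 2 * β ≤ a * b → (b : ℝ) ≤ #S → #S ≤ 2 ^ k * a := by
    intro a b hab hb
    have h1 : (#S : ℝ) * β ≤ a := by
      have : (a : ℝ) * b ≤ a * #S := by gcongr
      nlinarith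
    have h2 : (#S : ℝ) ≤ 2 ^ k * a := by
      calc (#S : ℝ) ≤ (2 ^ k * β) * #S := le_mul_of_one_le_left (by positivity) hβk
        _ = 2 ^ k * (#S * β) := by ring
        _ ≤ _ := by gcongr
    exact_mod_cast h2
  exact ⟨z, q, hqE, hconc _ _ hprod hb, hconc _ _ (hprod.trans_eq (mul_comm _ _)) ha⟩

end Signs

open Finset Classical in
/-- If the sign sums of a family of words over a finite alphabet of complex numbers are all
proportional to the length, then two far apart letters are shattered on a set of coordinates
of proportional size. -/
theorem exists_shattered_pair {L : Type*} [Fintype L] (v : L → ℂ) {θ : ℝ} (hθ : 0 < θ) :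
    ∃ δ : ℝ, 0 < δ ∧ ∃ n₀ : ℕ, ∀ (ι : Type) [Fintype ι], n₀ ≤ Fintype.card ι →
      ∀ S : Finset (ι → L), (∀ ε : ι → Bool, ∃ w ∈ S,
        θ * Fintype.card ι ≤ ‖∑ z, (boolSign (ε z) : ℂ) * v (w z)‖) →
      ∃ q : L × L, θ / 8 ≤ ‖v q.1 - v q.2‖ ∧ ∃ W : Finset ι, δ * Fintype.card ι ≤ #W ∧
        ∀ σ : ι → Bool, ∃ w ∈ S, ∀ z ∈ W, w z = bif σ z then q.1 else q.2 := by
  set M : ℝ := ∑ a, ‖v a‖ + 1 with hMdef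
  have hsumv : 0 ≤ ∑ a, ‖v a‖ := sum_nonneg fun a _ => norm_nonneg _
  have hM : 0 < M := by linarith
  have hv : ∀ a, ‖v a‖ ≤ M := fun a => by
    have := single_le_sum (f := fun a => ‖v a‖) (fun a _ => norm_nonneg _) (Finset.mem_univ a)
    linarith
  set K := Fintype.card L
  obtain ⟨k, hk⟩ : ∃ k : ℕ, 16 * M * K ^ 2 ≤ 2 ^ k * θ := by
    obtain ⟨k, hk⟩ := pow_unbounded_of_one_lt (16 * M * K ^ 2 / θ) one_lt_two
    exact ⟨k, by rw [div_lt_iff₀ hθ] at hk; exact hk.le⟩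
  set c : ℝ := (θ / 4) ^ 2 / (2 * M ^ 2) with hc
  have hc0 : 0 < c := by positivity
  obtain ⟨y, hy0, hy⟩ : ∃ y : ℝ, 0 < y ∧ k * (K ^ 2 * Real.exp (-y)) ≤ c / 4 := by
    have hlim : Tendsto (fun y : ℝ => k * (K ^ 2 * Real.exp (-y))) atTop (nhds (k * (K ^ 2 * 0))) :=
      (Real.tendsto_exp_neg_atTop_nhds_zero.const_mul _).const_mul _
    have hpos : k * ((K : ℝ) ^ 2 * 0) < c / 4 := by rw [mul_zero, mul_zero]; positivity
    have h := hlim.eventually (ge_mem_nhds hpos)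
    obtain ⟨y, hy⟩ := ((eventually_gt_atTop 0).and h).exists
    exact ⟨y, hy⟩
  set δ : ℝ := c / (4 * (k + 1) * y) with hδ
  have hδ0 : 0 < δ := by positivity
  obtain ⟨n₀, hn₀⟩ := exists_nat_gt (8 / c)
  refine ⟨δ / (K ^ 2 + 1), by positivity, n₀, fun ι _ hn S hS => ?_⟩
  set n := Fintype.card ι
  have hnc : 8 < n * c := by
    rw [div_lt_iff₀ hc0] at hn₀
    exact hn₀.trans_le (by gcongr)
  have hn0 : (0 : ℝ) < n := by
    by_contra! h
    nlinarith
  obtain ⟨S₀, hS₀S, hsep, hcard⟩ := exists_separated hM hv hθ hS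
  set E : Set (L × L) := {q | θ / 8 ≤ ‖v q.1 - v q.2‖}
  have hE : ∀ q ∈ E, q.1 ≠ q.2 := by
    intro q hq h
    have : θ / 8 ≤ ‖v q.1 - v q.2‖ := hq
    rw [h, sub_self, norm_zero] at this
    linarith
  have hcubes : #S₀ ≤ #(shatteredCubes E S₀) ^ k :=
    card_le_card_shatteredCubes_pow hE (fun R hR hR1 =>
      exists_split_of_separated hM hv hθ hk
        (fun w hw w' hw' => hsep w (hR hw) w' (hR hw')) hR1) S₀ subset_rfl
  obtain ⟨h, hh, hsupp⟩ : ∃ h ∈ shatteredCubes E S₀, δ * n < #{z | h z ≠ none} := by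
    by_contra! hcon
    have h1 := card_le_exp_of_card_support_le hy0.le hcon
    have h2 : (#S₀ : ℝ) ≤ Real.exp (n * (c / 2)) := by
      calc (#S₀ : ℝ) ≤ (#(shatteredCubes E S₀) : ℝ) ^ k := by exact_mod_cast hcubes
        _ ≤ Real.exp (y * (δ * n) + n * (K ^ 2 * Real.exp (-y))) ^ k := by gcongr
        _ = Real.exp (n * (k * (y * δ) + k * (K ^ 2 * Real.exp (-y)))) := by
            rw [← Real.exp_nat_mul]
            ring_nf
        _ ≤ Real.exp (n * (c / 2)) := by
            have h3 : k * (y * δ) ≤ c / 4 := by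
              have : (k + 1) * (y * δ) = c / 4 := by
                rw [hδ]
                field_simp
              have : 0 ≤ y * δ := by positivity
              linarith
            gcongr
            linarith
    have h4 : Real.exp (n * c) = Real.exp (n * (c / 2)) * Real.exp (n * (c / 2)) := by
      rw [← Real.exp_add]
      ring_nf
    have h5 := Real.add_one_le_exp (n * (c / 2))
    have h6 := Real.exp_pos (n * (c / 2))
    rw [h4] at hcard
    nlinarith
  rw [mem_shatteredCubes] at hh
  obtain ⟨o, -, ho⟩ := exists_le_card_fiber_of_nsmul_le_card_of_maps_to
    (s := {z | h z ≠ none}) (t := (univ : Finset (Option (L × L)))) (f := h)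
    (b := δ / (K ^ 2 + 1) * n) (fun _ _ => Finset.mem_univ _) univ_nonempty (by
      refine le_trans (le_of_eq ?_) hsupp.le
      rw [nsmul_eq_mul, card_univ, Fintype.card_option, Fintype.card_prod]
      push_cast
      field_simp
      rfl)
  set W : Finset ι := {z ∈ ({z | h z ≠ none} : Finset ι) | h z = o}
  have hWpos : (0 : ℝ) < #W := lt_of_lt_of_le (by positivity) ho
  obtain ⟨z₀, hz₀⟩ := card_pos.1 (Nat.cast_pos.1 hWpos)
  simp only [W, mem_filter, Finset.mem_univ, true_and] at hz₀
  obtain ⟨q, hq⟩ := Option.ne_none_iff_exists'.1 hz₀.1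
  have hoq : o = some q := hz₀.2 ▸ hq
  refine ⟨q, hh.2 z₀ q hq, W, ho, fun σ => ?_⟩
  obtain ⟨w, hw, hw'⟩ := hh.1 σ
  refine ⟨w, hS₀S hw, fun z hz => hw' z q ?_⟩
  simp only [W, mem_filter, Finset.mem_univ, true_and] at hz
  exact hz.2.trans hoq

section Density

open Classical

lemma natCard_inter_Iic (J : Set ℕ) (n : ℕ) :
    Nat.card (J ∩ Set.Iic n : Set ℕ) = Nat.count (· ∈ J) (n + 1) := by
  rw [Nat.count_eq_card_filter_range, Nat.card_coe_set_eq, ← Set.ncard_coe_finset]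
  congr 1
  ext s
  simp [and_comm]

/-- If arbitrarily long initial segments of `J` have density at least `L`, then some shift of `J`
has density almost `L` on all short initial segments. -/
lemma exists_shift_count_ge_s5 {L ε : ℝ} (hL : 0 ≤ L) (hε : 0 < ε) (M : ℕ) {N : ℕ}
    (hN : M ≤ ε * (N - M)) {J : Set ℕ} (hJ : L * N ≤ Nat.count (· ∈ J) N) :
    ∃ k : ℕ, ∀ m ≤ M, (L - ε) * m ≤ Nat.count (fun s => k + s ∈ J) m := by
  obtain ⟨k, hk, hmin⟩ := Finset.exists_min_image (Finset.range (N + 1))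
    (fun k => (Nat.count (· ∈ J) k : ℝ) - (L - ε) * k) ⟨0, by simp⟩
  have h0 := hmin 0 (by simp)
  simp only [Nat.count_zero, Nat.cast_zero, mul_zero, sub_zero] at h0
  rw [Finset.mem_range] at hk
  have hkM : k + M ≤ N := by
    by_contra! hcon
    obtain ⟨l, rfl⟩ := Nat.exists_eq_add_of_le (Nat.lt_succ_iff.1 hk)
    have hl : l < M := by omega
    rw [Nat.count_add] at hJ
    have h1 : (Nat.count (fun s => k + s ∈ J) l : ℝ) ≤ l := by exact_mod_cast Nat.count_le _
    have h2 : (l : ℝ) < M := by exact_mod_cast hl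
    push_cast at hJ hN
    have h3 : (0 : ℝ) ≤ l := by positivity
    nlinarith [mul_nonneg hL h3]
  refine ⟨k, fun m hm => ?_⟩
  have h := hmin (k + m) (Finset.mem_range.2 (by omega))
  rw [Nat.count_add] at h
  push_cast at h
  linarith

/-- A closed shift-invariant family of subsets of `ℕ` having members of density at least `δ` on
arbitrarily long initial segments has a member whose density exists and is positive. -/
lemma exists_hasPosDensity {Y : Set (Set ℕ)}
    (hshift : ∀ J ∈ Y, ∀ k, {s | k + s ∈ J} ∈ Y)
    (hclosed : ∀ J : Set ℕ, (∀ m, ∃ J' ∈ Y, ∀ s < m, s ∈ J ↔ s ∈ J') → J ∈ Y)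
    {δ : ℝ} (hδ : 0 < δ)
    (hfreq : ∃ᶠ n : ℕ in atTop, ∃ J ∈ Y, δ * n ≤ Nat.count (· ∈ J) n) :
    ∃ J ∈ Y, HasPosDensity J := by
  set V : ℕ → Set ℕ := fun n => (fun J : Set ℕ => Nat.count (· ∈ J) n) '' Y with hV
  have hbdd : ∀ n, BddAbove (V n) := fun n => ⟨n, by
    rintro _ ⟨J, -, rfl⟩
    exact Nat.count_le _⟩
  have hne : ∀ n, (V n).Nonempty := by
    obtain ⟨_, J, hJ, -⟩ := hfreq.exists
    exact fun n => ⟨_, J, hJ, rfl⟩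
  set D : ℕ → ℕ := fun n => sSup (V n)
  have hle : ∀ J ∈ Y, ∀ n, Nat.count (· ∈ J) n ≤ D n := fun J hJ n => le_csSup (hbdd n) ⟨J, hJ, rfl⟩
  have hatt : ∀ n, ∃ J ∈ Y, Nat.count (· ∈ J) n = D n := fun n => Nat.sSup_mem (hne n) (hbdd n)
  have hsub : Subadditive fun n => (D n : ℝ) := by
    intro m n
    obtain ⟨J, hJ, hJD⟩ := hatt (m + n)
    rw [Nat.count_add] at hJD
    have h1 := hle J hJ m
    have h2 := hle _ (hshift J hJ m) n
    simp only [Set.mem_ofPred_eq] at h2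
    have h3 : D (m + n) ≤ D m + D n := by omega
    show (D (m + n) : ℝ) ≤ D m + D n
    exact_mod_cast h3
  have hbelow : BddBelow (Set.range fun n : ℕ => (D n : ℝ) / n) := ⟨0, by
    rintro _ ⟨n, rfl⟩
    positivity⟩
  set L := hsub.lim
  have hlim : Tendsto (fun n : ℕ => (D n : ℝ) / n) atTop (nhds L) := hsub.tendsto_lim hbelow
  have hLδ : δ ≤ L := by
    by_contra! hcon
    obtain ⟨n, ⟨J, hJ, hJn⟩, hn, hpos⟩ := (hfreq.and_eventually
      ((hlim.eventually (gt_mem_nhds hcon)).and (eventually_gt_atTop 0))).exists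
    have hn0 : (0 : ℝ) < n := by exact_mod_cast hpos
    rw [div_lt_iff₀ hn0] at hn
    have : (Nat.count (· ∈ J) n : ℝ) ≤ D n := by exact_mod_cast hle J hJ n
    linarith
  have hL0 : 0 < L := hδ.trans_le hLδ
  have hLD : ∀ n : ℕ, L * n ≤ D n := by
    intro n
    rcases Nat.eq_zero_or_pos n with rfl | hn
    · simp
    · have h := hsub.lim_le_div hbelow hn.ne'
      rwa [le_div_iff₀ (by exact_mod_cast hn)] at h
  have happrox : ∀ j : ℕ, ∃ J ∈ Y, ∀ m ≤ j,
      (L - 1 / ((j : ℝ) + 1)) * m ≤ Nat.count (· ∈ J) m := by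
    intro j
    obtain ⟨J, hJ, hJD⟩ := hatt (j + (j + 1) * j)
    obtain ⟨k, hk⟩ := exists_shift_count_ge_s5 (L := L) (ε := 1 / ((j : ℝ) + 1)) hL0.le
      (by positivity) j (N := j + (j + 1) * j) (by
        push_cast
        field_simp
        linarith) (J := J) (by rw [hJD]; exact hLD _)
    exact ⟨_, hshift J hJ k, hk⟩
  choose F hFY hF using happrox
  set 𝒰 : Ultrafilter ℕ := Filter.hyperfilter ℕ
  have h𝒰 : (𝒰 : Filter ℕ) ≤ atTop := Nat.hyperfilter_le_atTop
  set J : Set ℕ := {s | ∀ᶠ j in (𝒰 : Filter ℕ), s ∈ F j} with hJ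
  have hagree : ∀ m : ℕ, ∀ᶠ j in (𝒰 : Filter ℕ), ∀ s < m, s ∈ J ↔ s ∈ F j := by
    intro m
    refine (Set.finite_lt_nat m).eventually_all.2 fun s _ => ?_
    by_cases hs : s ∈ J
    · filter_upwards [show ∀ᶠ j in (𝒰 : Filter ℕ), s ∈ F j from hs] with j hj
      simp [hs, hj]
    · filter_upwards [Ultrafilter.eventually_not.2 (show ¬ ∀ᶠ j in (𝒰 : Filter ℕ), s ∈ F j from hs)]
        with j hj
      simp [hs, hj]
  have hJY : J ∈ Y := by
    refine hclosed J fun m => ?_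
    obtain ⟨j, hj⟩ := (hagree m).exists
    exact ⟨F j, hFY j, hj⟩
  have hJL : ∀ m : ℕ, L * m ≤ Nat.count (· ∈ J) m := by
    intro m
    have htend : Tendsto (fun j : ℕ => (L - 1 / ((j : ℝ) + 1)) * m) 𝒰 (nhds ((L - 0) * m)) :=
      ((tendsto_const_nhds.sub tendsto_one_div_add_atTop_nhds_zero_nat).mul_const _).mono_left h𝒰
    rw [sub_zero] at htend
    refine le_of_tendsto htend ?_
    filter_upwards [hagree m, h𝒰 (eventually_ge_atTop m)] with j hj hmj
    have : Nat.count (· ∈ J) m = Nat.count (· ∈ F j) m := by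
      simp only [Nat.count_eq_card_filter_range]
      congr 1
      exact Finset.filter_congr fun s hs => hj s (Finset.mem_range.1 hs)
    rw [this]
    exact hF j m hmj
  refine ⟨J, hJY, L, hL0.ne', ?_⟩
  simp_rw [natCard_inter_Iic]
  refine tendsto_of_tendsto_of_tendsto_of_le_of_le tendsto_const_nhds
    (hlim.comp (tendsto_add_atTop_nat 1)) (fun n => ?_) fun n => ?_
  · have := hJL (n + 1)
    push_cast at this
    exact (le_div_iff₀ (by positivity)).2 this
  · have : (Nat.count (· ∈ J) (n + 1) : ℝ) ≤ D (n + 1) := by exact_mod_cast hle J hJY (n + 1)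
    simp only [Function.comp_apply, Nat.cast_add, Nat.cast_one]
    gcongr

end Density

section IndependenceSets

variable {X : Type*} {T : X → X} {k : ℕ} {A B : Fin k → Set X} {J : Set ℕ}

lemma IsIndepSet.shift (hJ : IsIndepSet T A J) (m : ℕ) : IsIndepSet T A {s | m + s ∈ J} := by
  intro I hI hIJ σ
  obtain ⟨p, hp⟩ := hJ (I.image (m + ·)) (hI.image _) (by
    intro s hs
    obtain ⟨t, ht, rfl⟩ := Finset.mem_image.1 (Finset.mem_coe.1 hs)
    exact hIJ ht) fun s => σ (s - m)
  refine ⟨T^[m] p, ?_⟩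
  simp only [mem_iInter, mem_preimage] at hp ⊢
  intro s hs
  have h := hp (m + s) (Finset.mem_image_of_mem _ hs)
  rwa [add_comm, Function.iterate_add_apply, Nat.add_sub_cancel] at h

lemma IsIndepSet.of_forall_initial_segment
    (hJ : ∀ m, ∃ J', IsIndepSet T A J' ∧ ∀ s < m, s ∈ J ↔ s ∈ J') : IsIndepSet T A J := by
  intro I hI hIJ σ
  obtain ⟨J', hJ', h⟩ := hJ (I.sup id + 1)
  refine hJ' I hI (fun s hs => (h s ?_).1 (hIJ hs)) σ
  exact Nat.lt_succ_of_le (Finset.le_sup (f := id) (Finset.mem_coe.1 hs))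

lemma HasIndepSetPosDensity.mono (hAB : ∀ i, A i ⊆ B i) (hA : HasIndepSetPosDensity T A) :
    HasIndepSetPosDensity T B := by
  obtain ⟨J, hJ, hJd⟩ := hA
  refine ⟨J, fun I hI hIJ σ => ?_, hJd⟩
  obtain ⟨p, hp⟩ := hJ I hI hIJ σ
  exact ⟨p, iInter₂_mono (fun s _ => preimage_mono (hAB (σ s))) hp⟩

open Classical in
lemma hasIndepSetPosDensity_of_frequently {δ : ℝ} (hδ : 0 < δ)
    (h : ∃ᶠ n : ℕ in atTop, ∃ J : Set ℕ, IsIndepSet T A J ∧ δ * n ≤ Nat.count (· ∈ J) n) :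
    HasIndepSetPosDensity T A :=
  exists_hasPosDensity (Y := {J | IsIndepSet T A J}) (fun _ hJ m => hJ.shift m)
    (fun _ hJ => IsIndepSet.of_forall_initial_segment hJ) hδ h

open Classical in
lemma HasPosDensity.exists_eventually_le_count {J : Set ℕ} (hJ : HasPosDensity J) :
    ∃ d : ℝ, 0 < d ∧ ∀ᶠ n : ℕ in atTop, d * n ≤ Nat.count (· ∈ J) n := by
  obtain ⟨d, hd, hlim⟩ := hJ
  have hd0 : 0 < d := lt_of_le_of_ne (ge_of_tendsto' hlim fun n => by positivity) hd.symm
  refine ⟨d / 2, half_pos hd0, ?_⟩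
  have h := hlim.eventually (lt_mem_nhds (half_lt_self hd0))
  rw [← map_add_atTop_eq_nat 1, eventually_map]
  filter_upwards [h] with n hn
  rw [natCard_inter_Iic, lt_div_iff₀ (by positivity)] at hn
  push_cast
  exact hn.le

end IndependenceSets

section IsomorphismSets

variable {X : Type*} [TopologicalSpace X] {T : X → X}

lemma sum_smul_comp_iterate_apply (hT : Continuous T) (f : C(X, ℂ)) (I : Finset ℕ) (c : ℕ → ℂ)
    (p : X) : (∑ s ∈ I, c s • f.comp ⟨T^[s], hT.iterate s⟩) p = ∑ s ∈ I, c s * f (T^[s] p) := by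
  simp [ContinuousMap.sum_apply]

variable [CompactSpace X]

lemma norm_sum_smul_comp_iterate_le (hT : Continuous T) (f : C(X, ℂ)) (I : Finset ℕ) (c : ℕ → ℂ) :
    ‖∑ s ∈ I, c s • f.comp ⟨T^[s], hT.iterate s⟩‖ ≤ ‖f‖ * ∑ s ∈ I, ‖c s‖ := by
  refine (norm_sum_le _ _).trans ?_
  rw [Finset.mul_sum]
  refine Finset.sum_le_sum fun s _ => ?_
  rw [norm_smul, mul_comm]
  refine mul_le_mul_of_nonneg_right ?_ (norm_nonneg _)
  exact (ContinuousMap.norm_le _ (norm_nonneg _)).2 fun p => f.norm_coe_le_norm _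

lemma re_mul_sub_ge {c a b d : ℂ} {ε : ℝ} (h : ‖a - b - d‖ ≤ 2 * ε) :
    (c * d).re - 2 * ε * ‖c‖ ≤ (c * a).re - (c * b).re := by
  have h1 := (abs_le.1 (Complex.abs_re_le_norm (c * (a - b - d)))).1
  rw [norm_mul] at h1
  have h2 : ‖c‖ * ‖a - b - d‖ ≤ ‖c‖ * (2 * ε) := by gcongr
  simp only [mul_sub, Complex.sub_re] at h1
  linarith

lemma sum_abs_re_le (hT : Continuous T) (f : C(X, ℂ)) {x y : X} {ε : ℝ} {J : Set ℕ}
    (hJ : IsIndepSet T ![{p | ‖f p - f x‖ < ε}, {p | ‖f p - f y‖ < ε}] J) {I : Finset ℕ}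
    (hI : I.Nonempty) (hIJ : ↑I ⊆ J) (c : ℕ → ℂ) :
    ∑ s ∈ I, |(c s * (f x - f y)).re| ≤
      2 * ‖∑ s ∈ I, c s • f.comp ⟨T^[s], hT.iterate s⟩‖ + 2 * ε * ∑ s ∈ I, ‖c s‖ := by
  obtain ⟨p, hp⟩ := hJ I hI hIJ fun s => if 0 ≤ (c s * (f x - f y)).re then 0 else 1
  obtain ⟨q, hq⟩ := hJ I hI hIJ fun s => if 0 ≤ (c s * (f x - f y)).re then 1 else 0
  simp only [mem_iInter, mem_preimage] at hp hq
  set F := ∑ s ∈ I, c s • f.comp ⟨T^[s], hT.iterate s⟩ with hF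
  have hterm : ∀ s ∈ I, |(c s * (f x - f y)).re| - 2 * ε * ‖c s‖ ≤
      (c s * f (T^[s] p)).re - (c s * f (T^[s] q)).re := by
    intro s hs
    have hps := hp s hs
    have hqs := hq s hs
    by_cases hc : 0 ≤ (c s * (f x - f y)).re
    · simp only [hc, if_true, Matrix.cons_val_zero, Matrix.cons_val_one, mem_ofPred_eq] at hps hqs
      rw [abs_of_nonneg hc]
      refine re_mul_sub_ge ?_
      have := norm_sub_le (f (T^[s] p) - f x) (f (T^[s] q) - f y)
      rw [show f (T^[s] p) - f (T^[s] q) - (f x - f y) =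
        (f (T^[s] p) - f x) - (f (T^[s] q) - f y) by ring]
      linarith
    · simp only [hc, if_false, Matrix.cons_val_zero, Matrix.cons_val_one, mem_ofPred_eq] at hps hqs
      rw [abs_of_neg (not_le.1 hc), ← Complex.neg_re, ← mul_neg]
      refine re_mul_sub_ge ?_
      have := norm_sub_le (f (T^[s] p) - f y) (f (T^[s] q) - f x)
      rw [show f (T^[s] p) - f (T^[s] q) - -(f x - f y) =
        (f (T^[s] p) - f y) - (f (T^[s] q) - f x) by ring]
      linarith
  have hsum := Finset.sum_le_sum hterm
  rw [Finset.sum_sub_distrib, Finset.sum_sub_distrib, ← Finset.mul_sum, ← Complex.re_sum,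
    ← Complex.re_sum, ← sum_smul_comp_iterate_apply hT, ← sum_smul_comp_iterate_apply hT,
    ← hF] at hsum
  have h1 := (Complex.re_le_norm (F p)).trans (F.norm_coe_le_norm p)
  have h2 := (abs_le.1 (Complex.abs_re_le_norm (F q))).1
  have h3 := F.norm_coe_le_norm q
  linarith

/-- An independence set for neighbourhoods on which `f` is close to two different values is an
`ℓ¹`-isomorphism set for `f`. -/
lemma norm_sum_ge_of_isIndepSet (hT : Continuous T) (f : C(X, ℂ)) {x y : X} {J : Set ℕ}
    (hJ : IsIndepSet T ![{p | ‖f p - f x‖ < ‖f x - f y‖ / 8},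
      {p | ‖f p - f y‖ < ‖f x - f y‖ / 8}] J) {I : Finset ℕ} (hIJ : ↑I ⊆ J) (c : ℕ → ℂ) :
    ‖f x - f y‖ / 8 * ∑ s ∈ I, ‖c s‖ ≤ ‖∑ s ∈ I, c s • f.comp ⟨T^[s], hT.iterate s⟩‖ := by
  rcases I.eq_empty_or_nonempty with rfl | hI
  · simp
  have hre := sum_abs_re_le hT f hJ hI hIJ c
  have him := sum_abs_re_le hT f hJ hI hIJ fun s => Complex.I * c s
  simp only [mul_smul, ← Finset.smul_sum, norm_smul, norm_mul, Complex.norm_I, one_mul,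
    mul_assoc, Complex.I_mul_re, abs_neg] at him
  have hle : ∑ s ∈ I, ‖c s‖ * ‖f x - f y‖ ≤
      ∑ s ∈ I, |(c s * (f x - f y)).re| + ∑ s ∈ I, |(c s * (f x - f y)).im| := by
    rw [← Finset.sum_add_distrib]
    refine Finset.sum_le_sum fun s _ => ?_
    rw [← norm_mul]
    exact Complex.norm_le_abs_re_add_abs_im _
  rw [← Finset.sum_mul] at hle
  linarith

lemma exists_isomorphismSet_of_isIETuple (hT : Continuous T) (f : C(X, ℂ)) {x y : X}
    (hxy : IsIETuple T ![x, y]) (hne : f x ≠ f y) :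
    ∃ lam : ℝ, 1 ≤ lam ∧ ∃ J : Set ℕ, HasPosDensity J ∧
      ∀ I : Finset ℕ, ↑I ⊆ J → ∀ c : ℕ → ℂ,
        lam⁻¹ * ∑ s ∈ I, ‖c s‖ ≤ ‖∑ s ∈ I, c s • f.comp ⟨T^[s], hT.iterate s⟩‖ ∧
        ‖∑ s ∈ I, c s • f.comp ⟨T^[s], hT.iterate s⟩‖ ≤ lam * ∑ s ∈ I, ‖c s‖ := by
  have hd : 0 < ‖f x - f y‖ := norm_pos_iff.2 (sub_ne_zero.2 hne)
  have hopen : ∀ a : X, IsOpen {p | ‖f p - f a‖ < ‖f x - f y‖ / 8} := fun a =>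
    isOpen_lt (by fun_prop) continuous_const
  have hmem : ∀ a : X, a ∈ {p | ‖f p - f a‖ < ‖f x - f y‖ / 8} := fun a => by
    simpa using hd
  obtain ⟨J, hJ, hJd⟩ := hxy ![{p | ‖f p - f x‖ < ‖f x - f y‖ / 8},
    {p | ‖f p - f y‖ < ‖f x - f y‖ / 8}] (Fin.forall_fin_two.2 ⟨hopen x, hopen y⟩)
    (Fin.forall_fin_two.2 ⟨hmem x, hmem y⟩)
  set lam := max 1 (max ‖f‖ (8 / ‖f x - f y‖)) with hlam
  have hlam1 : 1 ≤ lam := le_max_left _ _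
  have hlam2 : ‖f‖ ≤ lam := (le_max_left _ _).trans (le_max_right _ _)
  have hlam3 : 8 / ‖f x - f y‖ ≤ lam := (le_max_right _ _).trans (le_max_right _ _)
  refine ⟨lam, hlam1, J, hJd, fun I hIJ c => ?_⟩
  have hc : 0 ≤ ∑ s ∈ I, ‖c s‖ := Finset.sum_nonneg fun s _ => norm_nonneg _
  constructor
  · refine le_trans (mul_le_mul_of_nonneg_right ?_ hc) (norm_sum_ge_of_isIndepSet hT f hJ hIJ c)
    rw [← inv_div]
    exact inv_anti₀ (by positivity) hlam3
  · exact (norm_sum_smul_comp_iterate_le hT f I c).trans (mul_le_mul_of_nonneg_right hlam2 hc)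

lemma exists_sign_sum_ge (hT : Continuous T) (f : C(X, ℂ)) {lam : ℝ} (hlam : 1 ≤ lam)
    {Z : Finset ℕ} (hZ : Z.Nonempty)
    (h : ∀ c : ℕ → ℂ,
      lam⁻¹ * ∑ s ∈ Z, ‖c s‖ ≤ ‖∑ s ∈ Z, c s • f.comp ⟨T^[s], hT.iterate s⟩‖)
    (ε : Z → Bool) :
    ∃ p, lam⁻¹ / 2 * Fintype.card Z ≤ ‖∑ z : Z, (boolSign (ε z) : ℂ) * f (T^[z] p)‖ := by
  set c : ℕ → ℂ := fun s => if hs : s ∈ Z then (boolSign (ε ⟨s, hs⟩) : ℂ) else 0 with hc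
  have hcz : ∀ z : Z, c z = boolSign (ε z) := fun z => by simp [hc]
  have hnorm : ∑ s ∈ Z, ‖c s‖ = Fintype.card Z := by
    rw [← Finset.sum_coe_sort]
    simp_rw [hcz, norm_boolSign]
    simp
  have hl := h c
  rw [hnorm] at hl
  have hcard : (0 : ℝ) < Fintype.card Z := by
    rw [Fintype.card_coe]
    exact_mod_cast hZ.card_pos
  have hpos : 0 < lam⁻¹ * Fintype.card Z := by positivity
  by_contra! hcon
  have hlt : ‖∑ s ∈ Z, c s • f.comp ⟨T^[s], hT.iterate s⟩‖ < lam⁻¹ / 2 * Fintype.card Z := by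
    rw [ContinuousMap.norm_lt_iff _ (by positivity)]
    intro p
    rw [sum_smul_comp_iterate_apply hT, ← Finset.sum_coe_sort]
    simp only [hcz]
    exact hcon p
  linarith

/-- A compact space with no IE-pair separated by `f` has a finite `f`-fine labelling for which
labels with different `f`-values admit no independence sets of positive density. -/
lemma exists_labelling_of_forall_isIETuple [T2Space X] (f : C(X, ℂ))
    (h : ∀ x y : X, IsIETuple T ![x, y] → f x = f y) {η κ : ℝ} (hη : 0 < η) (hκ : 0 < κ) :
    ∃ (t : Finset X) (label : X → t), (∀ p, ‖f p - f (label p)‖ ≤ κ) ∧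
      ∀ a b : t, η ≤ ‖f a - f b‖ →
        ¬ HasIndepSetPosDensity T ![{p | label p = a}, {p | label p = b}] := by
  let _ : UniformSpace X := uniformSpaceOfCompactR1
  set K : Set (X × X) := {q | η ≤ ‖f q.1 - f q.2‖} with hK
  have hKc : IsCompact K := (isClosed_le continuous_const (by fun_prop)).isCompact
  have hU : ∀ q : K, ∃ U : Fin 2 → Set X, (∀ i, IsOpen (U i)) ∧ q.1.1 ∈ U 0 ∧ q.1.2 ∈ U 1 ∧
      ¬ HasIndepSetPosDensity T U := by
    rintro ⟨⟨x, y⟩, hq⟩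
    have hnot : ¬ IsIETuple T ![x, y] := fun hxy => by
      have hq : η ≤ ‖f x - f y‖ := hq
      rw [h x y hxy, sub_self, norm_zero] at hq
      linarith
    simp only [IsIETuple, not_forall] at hnot
    obtain ⟨U, hUo, hUm, hUn⟩ := hnot
    exact ⟨U, hUo, hUm 0, hUm 1, hUn⟩
  choose U hUo hU0 hU1 hUn using hU
  obtain ⟨V, hV, hVK⟩ := lebesgue_number_lemma hKc
    (U := fun q : K => U q 0 ×ˢ U q 1) (fun q => (hUo q 0).prod (hUo q 1))
    (fun q hq => mem_iUnion.2 ⟨⟨q, hq⟩, hU0 ⟨q, hq⟩, hU1 ⟨q, hq⟩⟩)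
  obtain ⟨W₀, hW₀, W₁, hW₁, hWV⟩ := entourageProd_subset hV
  have hf : {p : X × X | dist (f p.1) (f p.2) < κ} ∈ uniformity X :=
    (CompactSpace.uniformContinuous_of_continuous f.continuous) (Metric.dist_mem_uniformity hκ)
  set R := W₀ ∩ W₁ ∩ {p : X × X | dist (f p.1) (f p.2) < κ}
  have hR : R ∈ uniformity X := inter_mem (inter_mem hW₀ hW₁) hf
  obtain ⟨t, -, ht⟩ := isCompact_univ.elim_nhds_subcover (fun x : X => UniformSpace.ball x R)
    fun x _ => UniformSpace.ball_mem_nhds x hR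
  have hcov : ∀ p, ∃ a : t, p ∈ UniformSpace.ball (a : X) R := fun p => by
    obtain ⟨a, ha, hp⟩ := mem_iUnion₂.1 (ht (mem_univ p))
    exact ⟨⟨a, ha⟩, hp⟩
  choose label hlabel using hcov
  refine ⟨t, label, fun p => ?_, fun a b hab hind => ?_⟩
  · have h1 : dist (f (label p)) (f p) < κ := (hlabel p).2
    rw [dist_comm, dist_eq_norm] at h1
    exact h1.le
  · obtain ⟨q, hq⟩ := hVK (a, b) hab
    refine hUn q (hind.mono (Fin.forall_fin_two.2 ⟨fun p hp => ?_, fun p hp => ?_⟩))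
    · have hp : label p = a := hp
      subst hp
      exact (hq (hWV (show ((_, _), (p, (b : X))) ∈ entourageProd W₀ W₁ from
        ⟨(hlabel p).1.1, refl_mem_uniformity hW₁⟩))).1
    · have hp : label p = b := hp
      subst hp
      exact (hq (hWV (show ((_, _), ((a : X), p)) ∈ entourageProd W₀ W₁ from
        ⟨refl_mem_uniformity hW₀, (hlabel p).1.2⟩))).2

open Classical in
lemma exists_isIETuple_of_isomorphismSet [T2Space X] (hT : Continuous T) (f : C(X, ℂ)) {lam : ℝ}
    (hlam : 1 ≤ lam) {J : Set ℕ} (hJ : HasPosDensity J)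
    (hJf : ∀ I : Finset ℕ, ↑I ⊆ J → ∀ c : ℕ → ℂ,
      lam⁻¹ * ∑ s ∈ I, ‖c s‖ ≤ ‖∑ s ∈ I, c s • f.comp ⟨T^[s], hT.iterate s⟩‖) :
    ∃ x y : X, IsIETuple T ![x, y] ∧ f x ≠ f y := by
  by_contra! hcon
  have hlam0 : 0 < lam⁻¹ := by positivity
  set θ := lam⁻¹ / 4 with hθ
  have hθ0 : 0 < θ := by positivity
  obtain ⟨t, label, hlabel, hind⟩ := exists_labelling_of_forall_isIETuple (T := T) f hcon
    (η := θ / 8) (κ := θ) (by positivity) hθ0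
  obtain ⟨δ, hδ, n₀, hshatter⟩ := exists_shattered_pair (fun a : t => f a) hθ0
  obtain ⟨d, hd, hdens⟩ := hJ.exists_eventually_le_count
  have hsmall : ∀ᶠ n : ℕ in atTop, ∀ q : t × t, θ / 8 ≤ ‖f q.1 - f q.2‖ → ∀ J' : Set ℕ,
      IsIndepSet T ![{p | label p = q.1}, {p | label p = q.2}] J' →
        Nat.count (· ∈ J') n < δ * d * n := by
    rw [eventually_all]
    intro q
    by_cases hq : θ / 8 ≤ ‖f q.1 - f q.2‖
    · have h := mt (hasIndepSetPosDensity_of_frequently (mul_pos hδ hd)) (hind q.1 q.2 hq)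
      rw [not_frequently] at h
      filter_upwards [h] with n hn _ J' hJ'
      by_contra! hle
      exact hn ⟨J', hJ', hle⟩
    · exact Eventually.of_forall fun n h => absurd h hq
  obtain ⟨N, hN⟩ := exists_nat_gt ((n₀ + 1) / d)
  obtain ⟨n, hn1, hn2, hn3⟩ := (hdens.and (hsmall.and (eventually_ge_atTop N))).exists
  set Z := {s ∈ Finset.range n | s ∈ J} with hZ
  have hZcard : Z.card = Nat.count (· ∈ J) n := (Nat.count_eq_card_filter_range _ _).symm
  rw [← hZcard] at hn1
  have hZn₀ : n₀ + 1 ≤ Z.card := by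
    have h1 : (N : ℝ) ≤ n := by exact_mod_cast hn3
    rw [div_lt_iff₀ hd] at hN
    have h2 : ((n₀ : ℝ) + 1) ≤ Z.card := by nlinarith
    exact_mod_cast h2
  have hZJ : ↑Z ⊆ J := fun s hs => (Finset.mem_filter.1 (Finset.mem_coe.1 hs)).2
  have hS := (Set.toFinite (range fun (p : X) (z : Z) => label (T^[z] p)))
  obtain ⟨q, hq, W, hW, hWs⟩ := hshatter Z (by rw [Fintype.card_coe]; omega) hS.toFinset fun ε => by
    obtain ⟨p, hp⟩ := exists_sign_sum_ge hT f hlam (Finset.card_pos.1 (by omega)) (hJf Z hZJ) ε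
    refine ⟨_, hS.mem_toFinset.2 ⟨p, rfl⟩, ?_⟩
    have hdiff : ‖∑ z : Z, (boolSign (ε z) : ℂ) * f (T^[z] p) -
        ∑ z : Z, (boolSign (ε z) : ℂ) * f (label (T^[z] p))‖ ≤ Fintype.card Z * θ := by
      rw [← Finset.sum_sub_distrib]
      refine (norm_sum_le _ _).trans ((Finset.sum_le_card_nsmul _ _ θ fun z _ => ?_).trans_eq ?_)
      · rw [← mul_sub, norm_mul, norm_boolSign, one_mul]
        exact hlabel _
      · rw [nsmul_eq_mul, Finset.card_univ]
    have := norm_sub_norm_le (∑ z : Z, (boolSign (ε z) : ℂ) * f (T^[z] p))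
      (∑ z : Z, (boolSign (ε z) : ℂ) * f (label (T^[z] p)))
    rw [hθ] at hdiff ⊢
    linarith
  have hWcount : W.card ≤ Nat.count (· ∈ ((↑) : Z → ℕ) '' W) n := by
    rw [Nat.count_eq_card_filter_range, ← Finset.card_map (Function.Embedding.subtype _)]
    refine Finset.card_le_card fun s hs => ?_
    obtain ⟨z, hz, rfl⟩ := Finset.mem_map.1 hs
    exact Finset.mem_filter.2 ⟨(Finset.mem_filter.1 z.2).1, z, hz, rfl⟩
  have hlt := hn2 q hq (((↑) : Z → ℕ) '' W) fun I _ hIW σ => by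
    obtain ⟨w, hw, hwσ⟩ := hWs fun z => σ z = 0
    obtain ⟨p, rfl⟩ := hS.mem_toFinset.1 hw
    refine ⟨p, mem_iInter₂.2 fun s hs => ?_⟩
    obtain ⟨z, hz, rfl⟩ := hIW hs
    have h := hwσ z hz
    have h01 : ∀ i : Fin 2, i = 0 ∨ i = 1 := by decide
    rcases h01 (σ z) with h0 | h0 <;> simpa [h0] using h
  have h1 : (W.card : ℝ) ≤ Nat.count (· ∈ ((↑) : Z → ℕ) '' W) n := by exact_mod_cast hWcount
  rw [Fintype.card_coe] at hW
  have h2 : δ * (d * n) ≤ δ * Z.card := by gcongr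
  linarith

end IsomorphismSets

/-- Proposition `P-f to pair E`.  `f` has an ℓ1-isomorphism set of positive
density iff there is an IE-pair `(x, y)` with `f x ≠ f y`. -/
theorem stmt5 {X : Type*} [TopologicalSpace X] [CompactSpace X] [T2Space X]
    (T : X → X) (hT : Continuous T) (hTsurj : Function.Surjective T)
    (f : C(X, ℂ)) :
    (∃ lam : ℝ, 1 ≤ lam ∧ ∃ J : Set ℕ, HasPosDensity J ∧
        ∀ I : Finset ℕ, ↑I ⊆ J → ∀ c : ℕ → ℂ,
          lam⁻¹ * ∑ s ∈ I, ‖c s‖ ≤ ‖∑ s ∈ I, c s • f.comp ⟨T^[s], hT.iterate s⟩‖ ∧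
          ‖∑ s ∈ I, c s • f.comp ⟨T^[s], hT.iterate s⟩‖ ≤ lam * ∑ s ∈ I, ‖c s‖) ↔
      ∃ x y : X, IsIETuple T ![x, y] ∧ f x ≠ f y := by
  constructor
  · rintro ⟨lam, hlam, J, hJ, hJf⟩
    exact exists_isIETuple_of_isomorphismSet hT f hlam hJ fun I hI c => (hJf I hI c).1
  · rintro ⟨x, y, hxy, hne⟩
    exact exists_isomorphismSet_of_isIETuple hT f hxy hne
end
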